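/- Let k > r ≥ 2 be integers with r composite, and set j = j_{k,r}. If either (i) j = 2 and k ≥ 2r − 3, or (ii) j ≥ 3 and k ≥ (π(r))³·(r−2), then w_2(k;r) = rk − j(r−2). -/

import Mathlib

/-- `vdwProp r k n` says: every coloring `χ` of `{1,...,n}` with colors `0,...,r-1`
admits, for some color `i < r`, a `k i`-term arithmetic progression
`a, a+d, ..., a+(k i - 1)d` (with `a ≥ 1`, `d ≥ 1`) contained in `{1,...,n}`,
all of whose elements have color `i`. -/
def vdwProp (r : ℕ) (k : ℕ → ℕ) (n : ℕ) : Prop :=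
  ∀ χ : ℕ → ℕ, (∀ x, 1 ≤ x → x ≤ n → χ x < r) →
    ∃ i < r, ∃ a, 1 ≤ a ∧ ∃ d, 1 ≤ d ∧ a + (k i - 1) * d ≤ n ∧
      ∀ t < k i, χ (a + t * d) = i

/-- The length function for `w₂(k;r) = w(k,2,2,...,2;r)`: color `0` must avoid
`k`-term APs, every other color must avoid `2`-term APs. -/
def twoColors (k : ℕ) : ℕ → ℕ := fun i => if i = 0 then k else 2

/-- `#r`: the product of all primes not exceeding `r`. -/
def primorialUpTo (r : ℕ) : ℕ := ∏ p ∈ Finset.filter Nat.Prime (Finset.range (r + 1)), p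

/-- `j_{k,r} = min { j ≥ 0 : gcd(k - j, #r) = 1 }`. -/
noncomputable def jkr (k r : ℕ) : ℕ := sInf {j : ℕ | Nat.gcd (k - j) (primorialUpTo r) = 1}

/-- `ℓ_{k,r} = min { ℓ ≥ 0 : gcd(k - ℓ, #r) = r }`. -/
noncomputable def lkr (k r : ℕ) : ℕ := sInf {l : ℕ | Nat.gcd (k - l) (primorialUpTo r) = r}

/-! ### Arithmetic progressions avoiding few points -/

/-- The points `k + i * m` with `i ≤ r - 2` meet every `k`-term progression of `{1, …, n}`. -/
lemma exists_progression_hit {k r j m n a d : ℕ} (hr : 3 ≤ r) (hj : 2 ≤ j) (hm : k = m + j)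
    (hm0 : 0 < m) (hcop : ∀ d, 1 ≤ d → d ≤ r → Nat.Coprime d m) (hn : n < r * m + 2 * j)
    (ha : 1 ≤ a) (hd : 1 ≤ d) (had : a + (k - 1) * d ≤ n) :
    ∃ t < k, ∃ i ≤ r - 2, a + t * d = k + i * m := by
  obtain ⟨k', rfl⟩ : ∃ k', k = k' + 1 := ⟨k - 1, by omega⟩
  obtain ⟨r', rfl⟩ : ∃ r', r = r' + 2 := ⟨r - 2, by omega⟩
  simp only [Nat.add_sub_cancel] at had ⊢
  have hdr : d < r' + 2 := by
    by_contra! h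
    have h1 : k' * (r' + 2) ≤ k' * d := Nat.mul_le_mul_left _ h
    have h2 : k' + 1 = m + j := hm
    have h3 : k' = m + j - 1 := by omega
    obtain ⟨j', rfl⟩ : ∃ j', j = j' + 1 := ⟨j - 1, by omega⟩
    have h4 : k' = m + j' := by omega
    subst h4
    nlinarith
  -- an index with the right residue
  obtain ⟨i0, hi0, hmod⟩ : ∃ i0 < d, (k' + 1 + i0 * m) ≡ a [MOD d] := by
    have hc := hcop d hd hdr.le
    have hu : IsUnit ((m : ℕ) : ZMod d) := (ZMod.isUnit_iff_coprime m d).2 hc.symm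
    have : NeZero d := ⟨by omega⟩
    obtain ⟨u, hu⟩ := hu
    refine ⟨(((a : ZMod d) - ((k' + 1 : ℕ) : ZMod d)) * (u⁻¹ : (ZMod d)ˣ)).val, ZMod.val_lt _, ?_⟩
    rw [← ZMod.natCast_eq_natCast_iff]
    push_cast
    rw [ZMod.natCast_val, ZMod.cast_id', id, ← hu, mul_assoc, Units.inv_mul]
    ring
  by_contra! hno
  have key : ∀ i x, a ≤ k' + 1 + x → x = i * m → i ≤ r' → (k' + 1 + i * m) ≡ a [MOD d] →
      a + k' * d < k' + 1 + i * m := by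
    intro i x hx hxi hi hmod'
    subst hxi
    by_contra! hle
    have hdvd : d ∣ (k' + 1 + i * m) - a := (Nat.modEq_iff_dvd' hx).1 hmod'.symm
    obtain ⟨t, ht⟩ := hdvd
    have h1 : a + t * d = k' + 1 + i * m := by rw [mul_comm t d]; omega
    have h2 : t * d ≤ k' * d := by omega
    have h3 : t ≤ k' := Nat.le_of_mul_le_mul_right h2 hd
    exact hno t (by omega) i hi h1
  have hall : ∀ q, i0 + q * d ≤ r' → k' + 1 + (i0 + q * d) * m < a := by
    intro q
    induction q with
    | zero =>
      intro h
      by_contra! hle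
      have h1 := key (i0 + 0 * d) _ hle rfl h (by simpa using hmod)
      have h2 : i0 * m ≤ (d - 1) * m := Nat.mul_le_mul_right _ (by omega)
      obtain ⟨d', rfl⟩ : ∃ d', d = d' + 1 := ⟨d - 1, by omega⟩
      have h3 : d' * m ≤ d' * k' := Nat.mul_le_mul_left _ (by omega)
      simp only [Nat.add_sub_cancel] at h2
      have h4 : (i0 + 0 * (d' + 1)) * m = i0 * m := by ring
      have h5 : k' * (d' + 1) = d' * k' + k' := by ring
      omega
    | succ q ih =>
      intro h
      have hq : i0 + q * d ≤ r' := by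
        have : (q + 1) * d = q * d + d := by ring
        omega
      have h0 := ih hq
      by_contra! hle
      have hmq : (k' + 1 + (i0 + (q + 1) * d) * m) ≡ a [MOD d] := by
        have : k' + 1 + (i0 + (q + 1) * d) * m = k' + 1 + i0 * m + d * ((q + 1) * m) := by ring
        rw [this, Nat.add_comm]
        exact (Nat.add_modEq_right_iff.2 (dvd_mul_right _ _)).trans hmod
      have h1 := key _ _ hle rfl h hmq
      have h2 : (i0 + (q + 1) * d) * m = (i0 + q * d) * m + d * m := by ring
      have h3 : d * m ≤ k' * d := by rw [mul_comm k' d]; exact Nat.mul_le_mul_left _ (by omega)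
      omega
  have hq := hall ((r' - i0) / d) (by
    have := Nat.div_mul_le_self (r' - i0) d
    omega)
  have h1 : r' < i0 + (r' - i0) / d * d + d := by
    have := Nat.lt_div_mul_add (a := r' - i0) (b := d) hd
    omega
  set i := i0 + (r' - i0) / d * d with hi
  have h2 : (r' + 1) * m ≤ (i + d) * m := Nat.mul_le_mul_right _ h1
  have h3 : (k' + 1 + i * m) ≡ a [MOD d] := by
    have : k' + 1 + i * m = k' + 1 + i0 * m + d * ((r' - i0) / d * m) := by rw [hi]; ring
    rw [this, Nat.add_comm]
    exact (Nat.add_modEq_right_iff.2 (dvd_mul_right _ _)).trans hmod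
  have h4 : d ∣ a - (k' + 1 + i * m) := (Nat.modEq_iff_dvd' hq.le).1 h3
  have h5 : d ≤ a - (k' + 1 + i * m) := Nat.le_of_dvd (by omega) h4
  have h6 : k' * d + d = m * d + j * d := by rw [← Nat.succ_mul, Nat.succ_eq_add_one, hm]; ring
  have h7 : j ≤ j * d := Nat.le_mul_of_pos_right _ hd
  have h8 : (r' + 2) * m = (r' + 1) * m + m := by ring
  have h9 : (i + d) * m = i * m + m * d := by ring
  omega

lemma not_vdwProp_of_lt {k r j m n : ℕ} (hr : 3 ≤ r) (hj : 2 ≤ j) (hm : k = m + j)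
    (hm0 : 0 < m) (hcop : ∀ d, 1 ≤ d → d ≤ r → Nat.Coprime d m) (hn : n < r * m + 2 * j) :
    ¬ vdwProp r (twoColors k) n := by
  intro hv
  obtain ⟨i, hi, a, ha, d, hd, had, hmono⟩ := hv
    (fun x => if ∃ i ≤ r - 2, x = k + i * m then (x - k) / m + 1 else 0) (by
      intro x _ _
      split_ifs with h
      · obtain ⟨i, hi, rfl⟩ := h
        rw [Nat.add_sub_cancel_left, Nat.mul_div_cancel _ hm0]
        omega
      · omega)
  rcases Nat.eq_zero_or_pos i with rfl | hi0
  · simp only [twoColors, if_true] at had hmono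
    obtain ⟨t, ht, i, hi', hti⟩ := exists_progression_hit hr hj hm hm0 hcop hn ha hd had
    have := hmono t ht
    rw [if_pos ⟨i, hi', hti⟩] at this
    exact Nat.succ_ne_zero _ this
  · have hne : i ≠ 0 := by omega
    simp only [twoColors, hne, if_false] at had hmono
    have h0 := hmono 0 (by norm_num)
    have h1 := hmono 1 (by norm_num)
    split_ifs at h0 with c0
    swap
    · omega
    split_ifs at h1 with c1
    swap
    · omega
    obtain ⟨i0, hi0', e0⟩ := c0
    obtain ⟨i1, hi1', e1⟩ := c1
    rw [e0, Nat.add_sub_cancel_left, Nat.mul_div_cancel _ hm0] at h0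
    rw [e1, Nat.add_sub_cancel_left, Nat.mul_div_cancel _ hm0] at h1
    have : i0 = i1 := by omega
    subst this
    omega

/-- A strictly increasing sequence `0 = s 0 < ⋯ < s r = n + 1` leaves a `k`-term progression
unhit. -/
lemma exists_progression_avoiding {k r j n : ℕ} (s : ℕ → ℕ) (hr : 3 ≤ r)
    (hs : ∀ i < r, s i < s (i + 1)) (hs0 : s 0 = 0) (hsr : s r = n + 1) (hjk : j < k)
    (hn : n + j * (r - 2) = r * k) (hp : ∀ l < j, ∃ p, p.Prime ∧ p < r ∧ p ∣ k - l)
    (hbig : j * (r - 2) ≤ k) :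
    ∃ a d, 1 ≤ a ∧ 1 ≤ d ∧ a + (k - 1) * d ≤ n ∧ ∀ t < k, ∀ i ≤ r, a + t * d ≠ s i := by
  by_contra! hno
  have hmono : ∀ i i', i < i' → i' ≤ r → s i < s i' := by
    intro i i' h
    induction i', h using Nat.le_induction with
    | base => intro h; exact hs i (by omega)
    | succ x hx ih => intro h; exact (ih (by omega)).trans (hs x (by omega))
  have hmono' : ∀ i i', i ≤ r → s i < s i' → i' ≤ r → i < i' := by
    intro i i' hi h hi'
    by_contra! hle
    rcases hle.lt_or_eq with h1 | rfl
    · have := hmono _ _ h1 hi; omega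
    · omega
  have hmonole : ∀ i i', i ≤ i' → i' ≤ r → s i ≤ s i' := by
    intro i i' h h'
    rcases h.lt_or_eq with h1 | rfl
    · exact (hmono _ _ h1 h').le
    · rfl
  have hgap : ∀ i < r, s (i + 1) ≤ s i + k := by
    intro i hi
    by_contra! hlt
    have h1 : s (i + 1) ≤ n + 1 := hsr ▸ hmonole _ _ (by omega) le_rfl
    obtain ⟨t, ht, i', hi', h⟩ := hno (s i + 1) 1 (by omega) le_rfl (by omega)
    have h2 := hmono' i i' (by omega) (by omega) hi'
    have h3 := hmono' i' (i + 1) (by omega) (by omega) (by omega)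
    omega
  have hgaps : ∀ x i, i + x ≤ r → s (i + x) ≤ s i + x * k := by
    intro x i
    induction x with
    | zero => intro _; simp
    | succ x ih =>
      intro h
      have h1 := ih (by omega)
      have h2 := hgap (i + x) (by omega)
      have h3 : (x + 1) * k = x * k + k := by ring
      have h4 : i + (x + 1) = i + x + 1 := by ring
      rw [h4]
      omega
  obtain ⟨i, hi1, hi2, hi3⟩ : ∃ i, 1 ≤ i ∧ i ≤ r - 2 ∧ s i + (k - j) < s (i + 1) := by
    by_contra! hsmall
    have h1 : ∀ i ≤ r - 2, s (i + 1) ≤ k + i * (k - j) := by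
      intro i
      induction i with
      | zero => intro _; have := hgap 0 (by omega); rw [zero_add] at this ⊢; omega
      | succ i ih =>
        intro h
        have h1 := ih (by omega)
        have h2 := hsmall (i + 1) (by omega) h
        have h3 : (i + 1) * (k - j) = i * (k - j) + (k - j) := by ring
        omega
    have h2 := h1 (r - 2) le_rfl
    have h3 := hgap (r - 2 + 1) (by omega)
    have h4 : r - 2 + 1 + 1 = r := by omega
    rw [h4] at h3
    obtain ⟨r', rfl⟩ : ∃ r', r = r' + 2 := ⟨r - 2, by omega⟩
    obtain ⟨m, rfl⟩ : ∃ m, k = m + j := ⟨k - j, by omega⟩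
    simp only [Nat.add_sub_cancel] at *
    have : (r' + 2) * (m + j) = r' * m + r' * j + 2 * (m + j) := by ring
    have : j * r' = r' * j := by ring
    omega
  have hi4 := hgap i (by omega)
  obtain ⟨p, hp1, hp2, hp3⟩ := hp (s i + k - s (i + 1)) (by omega)
  have hp3' : p ∣ s (i + 1) - s i := by
    convert hp3 using 1
    omega
  have hp4 := hp1.two_le
  obtain ⟨b, hb1, hb2, hb3⟩ : ∃ b, b ≤ i - 1 ∧ i ≤ b + p - 1 ∧ b + p + 1 ≤ r := by
    rcases le_total i (r - p) with h | h
    · exact ⟨i - 1, by omega, by omega, by omega⟩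
    · exact ⟨r - p - 1, by omega, by omega, by omega⟩
  -- a residue class missed by the window `s (b + 1), …, s (b + p)`
  obtain ⟨c, hc, hcmiss⟩ : ∃ c < p, ∀ x < p, s (b + 1 + x) % p ≠ c := by
    by_contra! hsur
    have h1 : Finset.range p ⊆
        ((Finset.range p).erase (i - b)).image (fun x => s (b + 1 + x) % p) := by
      intro c hc
      obtain ⟨x, hx, hxc⟩ := hsur c (Finset.mem_range.1 hc)
      rw [Finset.mem_image]
      by_cases hxe : x = i - b
      · refine ⟨i - b - 1, ?_, ?_⟩
        · simp only [Finset.mem_erase, Finset.mem_range]; omega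
        · have e1 : b + 1 + (i - b - 1) = i := by omega
          have e2 : b + 1 + x = i + 1 := by omega
          simp only [e1]
          rw [e2] at hxc
          rw [← hxc]
          exact (Nat.modEq_iff_dvd' (by have := hs i (by omega); omega)).2 hp3'
      · exact ⟨x, by simp only [Finset.mem_erase, Finset.mem_range]; omega, hxc⟩
    have h2 := (Finset.card_le_card h1).trans Finset.card_image_le
    rw [Finset.card_erase_of_mem (by simp only [Finset.mem_range]; omega), Finset.card_range] at h2
    omega
  obtain ⟨a, ha1, ha2, ha3⟩ : ∃ a, s b < a ∧ a ≤ s b + p ∧ a % p = c := by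
    refine ⟨s b + 1 + (c + (p - (s b + 1) % p)) % p, by omega, ?_, ?_⟩
    · have := Nat.mod_lt (c + (p - (s b + 1) % p)) (by omega : 0 < p)
      omega
    · rw [Nat.add_mod_mod]
      have h1 := Nat.mod_lt (s b + 1) (by omega : 0 < p)
      have h2 := Nat.div_add_mod (s b + 1) p
      have h3 : s b + 1 + (c + (p - (s b + 1) % p)) = c + p * ((s b + 1) / p + 1) := by
        rw [mul_add, mul_one]; omega
      rw [h3, Nat.add_mul_mod_self_left, Nat.mod_eq_of_lt hc]
  have hlen : s b + k * p < s (b + p + 1) := by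
    have h1 := hgaps b 0 (by omega)
    have h2 := hgaps (r - (b + p + 1)) (b + p + 1) (by omega)
    have e1 : b + p + 1 + (r - (b + p + 1)) = r := by omega
    rw [e1, hsr] at h2
    rw [zero_add, hs0] at h1
    obtain ⟨y, hy⟩ : ∃ y, r = b + p + 1 + y := ⟨r - (b + p + 1), by omega⟩
    have e2 : r - (b + p + 1) = y := by omega
    have e3 : r * k = b * k + k * p + k + y * k := by rw [hy]; ring
    rw [e2] at h2
    omega
  have hle : s (b + p + 1) ≤ n + 1 := hsr ▸ hmonole _ _ hb3 le_rfl
  obtain ⟨k', rfl⟩ : ∃ k', k = k' + 1 := ⟨k - 1, by omega⟩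
  have e1 : (k' + 1) * p = k' * p + p := by ring
  obtain ⟨t, ht, i', hi', h⟩ := hno a p (by omega) (by omega) (by
    simp only [Nat.add_sub_cancel]; omega)
  have ht' : t * p ≤ k' * p := Nat.mul_le_mul_right _ (by omega)
  have h2 := hmono' b i' (by omega) (by omega) hi'
  have h3 := hmono' i' (b + p + 1) (by omega) (by omega) (by omega)
  apply hcmiss (i' - b - 1) (by omega)
  have e2 : b + 1 + (i' - b - 1) = i' := by omega
  rw [e2, ← h, Nat.add_mul_mod_self_right, ha3]

lemma vdwProp_of_dvd {k r j n : ℕ} (hr : 3 ≤ r) (hjk : j < k)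
    (hn : n + j * (r - 2) = r * k) (hp : ∀ l < j, ∃ p, p.Prime ∧ p < r ∧ p ∣ k - l)
    (hbig : j * (r - 2) ≤ k) : vdwProp r (twoColors k) n := by
  intro χ hχ
  by_contra! hno
  have hrn : r ≤ n := by
    have h1 : r * k = (r - 2) * k + 2 * k := by
      rw [← Nat.add_mul]; congr 1; omega
    have h2 : j * (r - 2) + (r - 2) ≤ k * (r - 2) := by
      rw [← Nat.succ_mul]; exact Nat.mul_le_mul_right _ hjk
    rw [mul_comm k] at h2
    omega
  set S := (Finset.Icc 1 n).filter (fun x => χ x ≠ 0) with hS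
  have hcard : S.card ≤ r - 1 := by
    have h1 : S.card ≤ (Finset.Icc 1 (r - 1)).card := by
      refine Finset.card_le_card_of_injOn χ ?_ ?_
      · intro x hx
        simp only [hS, Finset.coe_filter, Finset.mem_Icc, Set.mem_ofPred_eq] at hx
        have := hχ x hx.1.1 hx.1.2
        simp only [Finset.coe_Icc, Set.mem_Icc]
        omega
      · have aux : ∀ x ∈ S, ∀ y ∈ S, χ x = χ y → ¬ x < y := by
          intro x hx y hy hxy hlt
          simp only [hS, Finset.mem_filter, Finset.mem_Icc] at hx hy
          obtain ⟨t, ht, h⟩ := hno (χ x) (hχ x hx.1.1 hx.1.2) x hx.1.1 (y - x) (by omega)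
            (by simp only [twoColors, hx.2, if_false]; omega)
          simp only [twoColors, hx.2, if_false] at ht
          interval_cases t
          · simp at h
          · apply h
            rw [hxy]
            congr 1
            omega
        intro x hx y hy hxy
        have h1 := aux x hx y hy hxy
        have h2 := aux y hy x hx hxy.symm
        omega
    simpa using h1
  obtain ⟨U, hSU, hUn, hU⟩ := Finset.exists_subsuperset_card_eq
    (Finset.filter_subset _ _ : S ⊆ Finset.Icc 1 n) hcard (by simp; omega)
  let e := U.orderEmbOfFin hU
  have heU : ∀ i, e i ∈ Finset.Icc 1 n := fun i => hUn (Finset.orderEmbOfFin_mem U hU i)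
  simp only [Finset.mem_Icc] at heU
  let s : ℕ → ℕ := fun i => if i = 0 then 0 else if h : i - 1 < r - 1 then e ⟨i - 1, h⟩ else n + 1
  have hs : ∀ i < r, s i < s (i + 1) := by
    intro i hi
    simp only [s, Nat.add_sub_cancel, Nat.add_one_ne_zero, if_false]
    split_ifs with h1 h2 h2 h3 h3
    · exact (heU _).1
    · omega
    · apply e.strictMono
      simp only [Fin.mk_lt_mk]; omega
    · have := (heU ⟨i - 1, h2⟩).2; omega
    · omega
    · omega
  obtain ⟨a, d, ha, hd, had, h⟩ := exists_progression_avoiding s hr hs (by simp [s])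
    (by simp only [s]; rw [if_neg (by omega), dif_neg (by omega)]) hjk hn hp hbig
  obtain ⟨t, ht, hne⟩ := hno 0 (by omega) a ha d hd (by simpa [twoColors] using had)
  simp only [twoColors, if_true] at ht
  have hmem : a + t * d ∈ U := by
    apply hSU
    simp only [Finset.mem_filter, Finset.mem_Icc]
    refine ⟨⟨by omega, ?_⟩, hne⟩
    have : t * d ≤ (k - 1) * d := Nat.mul_le_mul_right _ (by omega)
    omega
  have hr' : a + t * d ∈ Set.range e := by
    rw [Finset.range_orderEmbOfFin]; exact hmem
  obtain ⟨i, hi⟩ := hr'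
  apply h t ht (i + 1) (by omega)
  simp only [s, Nat.add_sub_cancel, Nat.add_one_ne_zero, if_false]
  rw [dif_pos i.2, ← hi]

/-- The value of `w₂(k; r)`, given the size of `j` relative to `k`. -/
lemma isLeast_vdwProp_of_mul_le {k r : ℕ} (hr : 3 ≤ r) (hk : r < k) (hrc : ¬ r.Prime)
    (hj2 : 2 ≤ jkr k r) (hbig : jkr k r * (r - 2) ≤ k) :
    IsLeast {n : ℕ | 0 < n ∧ vdwProp r (twoColors k) n} (r * k - jkr k r * (r - 2)) := by
  have hne : {j : ℕ | Nat.gcd (k - j) (primorialUpTo r) = 1}.Nonempty :=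
    ⟨k - 1, by simp [show k - (k - 1) = 1 by omega]⟩
  have hmem : Nat.gcd (k - jkr k r) (primorialUpTo r) = 1 := Nat.sInf_mem hne
  have hlt : ∀ l < jkr k r, Nat.gcd (k - l) (primorialUpTo r) ≠ 1 :=
    fun l hl h => Nat.notMem_of_lt_sInf hl h
  set j := jkr k r with hj
  have hjk : j < k := by
    have : j ≤ k - 1 := Nat.sInf_le (by simp [show k - (k - 1) = 1 by omega])
    omega
  have hdvd : ∀ p, p.Prime → p ≤ r → p ∣ primorialUpTo r := fun p hp hpr =>
    Finset.dvd_prod_of_mem _ (by simp [hp]; omega)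
  have hcop : ∀ d, 1 ≤ d → d ≤ r → Nat.Coprime d (k - j) := by
    intro d hd hdr
    refine Nat.coprime_of_dvd fun p hp hpd hpm => ?_
    have h1 := Nat.dvd_gcd hpm (hdvd p hp ((Nat.le_of_dvd hd hpd).trans hdr))
    rw [hmem] at h1
    exact hp.one_lt.ne' (Nat.dvd_one.1 h1)
  have hpr : ∀ l < j, ∃ p, p.Prime ∧ p < r ∧ p ∣ k - l := by
    intro l hl
    obtain ⟨p, hp, hpd⟩ := Nat.exists_prime_and_dvd (hlt l hl)
    have h1 := (Nat.dvd_gcd_iff.1 hpd)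
    obtain ⟨q, hq, hpq⟩ := (Prime.dvd_finsetProd_iff hp.prime _).1 h1.2
    simp only [Finset.mem_filter, Finset.mem_range] at hq
    have h2 : p = q := (Nat.prime_dvd_prime_iff_eq hp hq.2).1 hpq
    refine ⟨p, hp, ?_, h1.1⟩
    rcases (show p ≤ r by omega).lt_or_eq with h | h
    · exact h
    · exact absurd (h ▸ hp) hrc
  have hle : j * (r - 2) ≤ r * k := hbig.trans (Nat.le_mul_of_pos_left _ (by omega))
  have hsub : r * k - j * (r - 2) = r * (k - j) + 2 * j := by
    obtain ⟨m, hm⟩ : ∃ m, k = m + j := ⟨k - j, by omega⟩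
    obtain ⟨r', rfl⟩ : ∃ r', r = r' + 2 := ⟨r - 2, by omega⟩
    rw [hm]
    simp only [Nat.add_sub_cancel]
    have : (r' + 2) * (m + j) = (r' + 2) * m + 2 * j + j * r' := by ring
    omega
  refine ⟨⟨by omega, vdwProp_of_dvd hr hjk (Nat.sub_add_cancel hle) hpr hbig⟩, ?_⟩
  rintro n ⟨_, hv⟩
  by_contra! h
  exact not_vdwProp_of_lt hr hj2 (by omega) (by omega) hcop (by omega) hv

/-! ### Counting sifted integers in intervals -/

/-- The number of integers in `(α, α + y]` free of prime factors `≤ z`. -/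
noncomputable def sifted (z : ℕ) (α y : ℝ) : ℝ :=
  (((Finset.Ioc ⌊α⌋₊ ⌊α + y⌋₊).filter (fun n => ∀ p ≤ z, p.Prime → ¬ p ∣ n)).card : ℝ)

/-- The density `∏ (1 - 1 / p)` over the primes `p ≤ z`. -/
noncomputable def siftDensity (z : ℕ) : ℝ :=
  ∏ p ∈ (Finset.range (z + 1)).filter Nat.Prime, (1 - 1 / (p : ℝ))

lemma siftDensity_pos (z : ℕ) : 0 < siftDensity z := by
  refine Finset.prod_pos fun p hp => ?_
  have h : (2 : ℝ) ≤ p := by exact_mod_cast (Finset.mem_filter.1 hp).2.two_le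
  have : 1 / (p : ℝ) ≤ 1 / 2 := one_div_le_one_div_of_le (by norm_num) h
  linarith

lemma siftDensity_succ_of_prime {z : ℕ} (h : (z + 1).Prime) :
    siftDensity (z + 1) = siftDensity z * (1 - 1 / ((z + 1 : ℕ) : ℝ)) := by
  rw [siftDensity, Finset.range_add_one, Finset.filter_insert, if_pos h,
    Finset.prod_insert (by simp), mul_comm, siftDensity]

lemma siftDensity_succ_of_not_prime {z : ℕ} (h : ¬ (z + 1).Prime) :
    siftDensity (z + 1) = siftDensity z := by
  rw [siftDensity, Finset.range_add_one, Finset.filter_insert, if_neg h, siftDensity]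

lemma siftDensity_two : siftDensity 2 = 1 / 2 := by
  have h1 : siftDensity 1 = 1 := by
    rw [siftDensity, show (Finset.range (1 + 1)).filter Nat.Prime = ∅ by decide, Finset.prod_empty]
  rw [siftDensity_succ_of_prime (z := 1) Nat.prime_two, h1]
  norm_num

lemma sifted_nonneg (z : ℕ) (α y : ℝ) : 0 ≤ sifted z α y := Nat.cast_nonneg _

lemma mem_Ioc_floor {α y : ℝ} (hα : 0 ≤ α) (hy : 0 ≤ y) (n : ℕ) :
    n ∈ Finset.Ioc ⌊α⌋₊ ⌊α + y⌋₊ ↔ α < n ∧ (n : ℝ) ≤ α + y := by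
  rw [Finset.mem_Ioc, Nat.floor_lt hα, Nat.le_floor_iff (by positivity)]

lemma sifted_succ_of_not_prime {z : ℕ} (h : ¬ (z + 1).Prime) (α y : ℝ) :
    sifted (z + 1) α y = sifted z α y := by
  unfold sifted
  congr 2
  refine Finset.filter_congr fun n _ => ⟨fun H p hp => H p (by omega), fun H p hp hp' => ?_⟩
  rcases Nat.lt_or_eq_of_le hp with h1 | rfl
  · exact H p (by omega) hp'
  · exact absurd hp' h

lemma sifted_succ_of_prime {z : ℕ} (h : (z + 1).Prime) {α y : ℝ} (hα : 0 ≤ α) (hy : 0 ≤ y) :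
    sifted (z + 1) α y =
      sifted z α y - sifted z (α / ((z + 1 : ℕ) : ℝ)) (y / ((z + 1 : ℕ) : ℝ)) := by
  have hq : (0 : ℝ) < ((z + 1 : ℕ) : ℝ) := by positivity
  rw [eq_sub_iff_add_eq]
  unfold sifted
  set A := (Finset.Ioc ⌊α⌋₊ ⌊α + y⌋₊).filter (fun n => ∀ p ≤ z, p.Prime → ¬ p ∣ n) with hA
  have h1 : (Finset.Ioc ⌊α⌋₊ ⌊α + y⌋₊).filter (fun n => ∀ p ≤ z + 1, p.Prime → ¬ p ∣ n) =
      A.filter (fun n => ¬ (z + 1) ∣ n) := by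
    rw [hA, Finset.filter_filter]
    refine Finset.filter_congr fun n _ => ⟨fun H => ⟨fun p hp => H p (by omega), H _ le_rfl h⟩,
      fun H p hp hp' => ?_⟩
    rcases Nat.lt_or_eq_of_le hp with h1 | rfl
    · exact H.1 p (by omega) hp'
    · exact H.2
  have h2 : ((Finset.Ioc ⌊α / ((z + 1 : ℕ) : ℝ)⌋₊
      ⌊α / ((z + 1 : ℕ) : ℝ) + y / ((z + 1 : ℕ) : ℝ)⌋₊).filter
        (fun n => ∀ p ≤ z, p.Prime → ¬ p ∣ n)).card = (A.filter (fun n => (z + 1) ∣ n)).card := by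
    refine Finset.card_bij (fun n _ => (z + 1) * n) ?_ ?_ ?_
    · intro n hn
      rw [Finset.mem_filter, mem_Ioc_floor (by positivity) (by positivity), ← add_div,
        div_lt_iff₀ hq, le_div_iff₀ hq] at hn
      rw [Finset.mem_filter, hA, Finset.mem_filter, mem_Ioc_floor hα hy]
      refine ⟨⟨⟨?_, ?_⟩, fun p hp hp' hd => ?_⟩, dvd_mul_right _ _⟩
      · rw [Nat.cast_mul, mul_comm]; exact hn.1.1
      · rw [Nat.cast_mul, mul_comm]; exact hn.1.2
      · rcases hp'.dvd_mul.1 hd with h3 | h3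
        · have := (Nat.prime_dvd_prime_iff_eq hp' h).1 h3
          omega
        · exact hn.2 p hp hp' h3
    · intro a _ b _ hab
      exact Nat.eq_of_mul_eq_mul_left (Nat.succ_pos z) hab
    · intro n hn
      rw [Finset.mem_filter, hA, Finset.mem_filter, mem_Ioc_floor hα hy] at hn
      obtain ⟨⟨⟨h3, h4⟩, h5⟩, m, rfl⟩ := hn
      refine ⟨m, ?_, rfl⟩
      rw [Finset.mem_filter, mem_Ioc_floor (by positivity) (by positivity), ← add_div,
        div_lt_iff₀ hq, le_div_iff₀ hq]
      rw [Nat.cast_mul, mul_comm] at h3 h4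
      exact ⟨⟨h3, h4⟩, fun p hp hp' hd => h5 p hp hp' (hd.mul_left _)⟩
  rw [h1, h2]
  have := Finset.card_filter_add_card_filter_not (s := A) (p := fun n => (z + 1) ∣ n)
  rw [← this]
  push_cast
  ring

lemma card_filter_odd_Ioc (b : ℕ) :
    ((Finset.Ioc 0 b).filter (fun n => ¬ 2 ∣ n)).card = (b + 1) / 2 := by
  induction b with
  | zero => simp
  | succ b ih =>
    rw [show Finset.Ioc 0 (b + 1) = insert (b + 1) (Finset.Ioc 0 b) by ext; simp; omega,
      Finset.filter_insert]
    split_ifs with h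
    · rw [ih]; omega
    · rw [Finset.card_insert_of_notMem (by simp), ih]; omega

lemma abs_sifted_two_sub_le {α y : ℝ} (hα : 0 ≤ α) (hy : 0 ≤ y) :
    |sifted 2 α y - y * siftDensity 2| ≤ 1 := by
  have hle : ⌊α⌋₊ ≤ ⌊α + y⌋₊ := Nat.floor_le_floor (by linarith)
  have h1 : sifted 2 α y = ((⌊α + y⌋₊ + 1) / 2 : ℕ) - ((⌊α⌋₊ + 1) / 2 : ℕ) := by
    have h2 : (Finset.Ioc ⌊α⌋₊ ⌊α + y⌋₊).filter (fun n => ∀ p ≤ 2, p.Prime → ¬ p ∣ n) =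
        ((Finset.Ioc 0 ⌊α + y⌋₊).filter (fun n => ¬ 2 ∣ n)) \
          ((Finset.Ioc 0 ⌊α⌋₊).filter (fun n => ¬ 2 ∣ n)) := by
      ext n
      have : (∀ p ≤ 2, p.Prime → ¬ p ∣ n) ↔ ¬ 2 ∣ n := by
        refine ⟨fun H => H 2 le_rfl Nat.prime_two, fun H p hp hp' => ?_⟩
        have := hp'.two_le
        obtain rfl : p = 2 := by omega
        exact H
      simp only [Finset.mem_filter, Finset.mem_sdiff, Finset.mem_Ioc, this]
      omega
    have hsub : (Finset.Ioc 0 ⌊α⌋₊).filter (fun n => ¬ 2 ∣ n) ⊆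
        (Finset.Ioc 0 ⌊α + y⌋₊).filter (fun n => ¬ 2 ∣ n) :=
      Finset.filter_subset_filter _ (Finset.Ioc_subset_Ioc_right hle)
    rw [sifted, h2, Finset.card_sdiff_of_subset hsub, Nat.cast_sub (Finset.card_le_card hsub),
      card_filter_odd_Ioc, card_filter_odd_Ioc]
  have key : ∀ x : ℝ, 0 ≤ x → (((⌊x⌋₊ + 1) / 2 : ℕ) : ℝ) ≤ (x + 1) / 2 ∧
      (x - 1) / 2 < (((⌊x⌋₊ + 1) / 2 : ℕ) : ℝ) := by
    intro x hx
    have h3 := Nat.floor_le hx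
    have h4 := Nat.lt_floor_add_one x
    have h5 : 2 * ((⌊x⌋₊ + 1) / 2) ≤ ⌊x⌋₊ + 1 := by omega
    have h6 : ⌊x⌋₊ ≤ 2 * ((⌊x⌋₊ + 1) / 2) := by omega
    have h5' : 2 * (((⌊x⌋₊ + 1) / 2 : ℕ) : ℝ) ≤ ⌊x⌋₊ + 1 := by exact_mod_cast h5
    have h6' : (⌊x⌋₊ : ℝ) ≤ 2 * (((⌊x⌋₊ + 1) / 2 : ℕ) : ℝ) := by exact_mod_cast h6
    constructor <;> linarith
  have h2 := key α hα
  have h3 := key (α + y) (by positivity)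
  rw [h1, siftDensity_two, abs_le]
  constructor <;> linarith

lemma abs_sifted_sub_le {z : ℕ} (hz : 2 ≤ z) {α y : ℝ} (hα : 0 ≤ α) (hy : 0 ≤ y) :
    |sifted z α y - y * siftDensity z| ≤ 2 ^ (Nat.primeCounting z - 1) := by
  induction z, hz using Nat.le_induction generalizing α y with
  | base =>
    rw [show Nat.primeCounting 2 = 1 by decide]
    simpa using abs_sifted_two_sub_le hα hy
  | succ z hz ih =>
    have hmono : 1 ≤ Nat.primeCounting z := by
      have : Nat.primeCounting 2 = 1 := by decide
      rw [← this]
      exact Nat.monotone_primeCounting hz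
    by_cases hp : (z + 1).Prime
    · have hc : Nat.primeCounting (z + 1) = Nat.primeCounting z + 1 := by
        simp only [Nat.primeCounting, Nat.primeCounting']
        rw [Nat.count_succ, if_pos hp]
      have h1 := ih hα hy
      have h2 := ih (α := α / ((z + 1 : ℕ) : ℝ)) (y := y / ((z + 1 : ℕ) : ℝ)) (by positivity)
        (by positivity)
      rw [sifted_succ_of_prime hp hα hy, siftDensity_succ_of_prime hp, hc]
      have e : 2 ^ (Nat.primeCounting z + 1 - 1) = (2 : ℝ) ^ (Nat.primeCounting z - 1) * 2 := by
        rw [← pow_succ]; congr 1; omega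
      have e2 : y * (siftDensity z * (1 - 1 / ((z + 1 : ℕ) : ℝ))) =
        y * siftDensity z - y / ((z + 1 : ℕ) : ℝ) * siftDensity z := by ring
      rw [e, e2]
      rw [abs_le] at h1 h2 ⊢
      constructor <;> linarith
    · have hc : Nat.primeCounting (z + 1) = Nat.primeCounting z := by
        simp only [Nat.primeCounting, Nat.primeCounting']
        rw [Nat.count_succ, if_neg hp, add_zero]
      rw [sifted_succ_of_not_prime hp, siftDensity_succ_of_not_prime hp, hc]
      exact ih hα hy

/-- Sifting by the primes in `(z, w]` removes at most the multiples of each of them. -/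
lemma sifted_sub_sum_le {z w : ℕ} (hzw : z ≤ w) {α y : ℝ} (hα : 0 ≤ α) (hy : 0 ≤ y) :
    sifted z α y - ∑ p ∈ (Finset.Ioc z w).filter Nat.Prime, sifted z (α / p) (y / p) ≤
      sifted w α y := by
  have hmono : ∀ x, z ≤ x → ∀ {α y : ℝ}, sifted x α y ≤ sifted z α y := by
    intro x hx α y
    unfold sifted
    refine Nat.cast_le.2 (Finset.card_le_card fun n hn => ?_)
    rw [Finset.mem_filter] at hn ⊢
    exact ⟨hn.1, fun p hp => hn.2 p (hp.trans hx)⟩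
  induction w, hzw using Nat.le_induction with
  | base => simp
  | succ w hw ih =>
    have hI : Finset.Ioc z (w + 1) = insert (w + 1) (Finset.Ioc z w) := by
      ext; simp; omega
    rw [hI, Finset.filter_insert]
    split_ifs with hp
    · rw [Finset.sum_insert (by simp), sifted_succ_of_prime hp hα hy]
      have := hmono w hw (α := α / ((w + 1 : ℕ) : ℝ)) (y := y / ((w + 1 : ℕ) : ℝ))
      linarith
    · rw [sifted_succ_of_not_prime hp]
      exact ih

/-- Induction for the linear sieve: admissible functions `F` and `f` bound the sifted count. -/
lemma linear_sieve {A β : ℝ} {F f : ℝ → ℝ} {Z : ℕ} (hA : 0 < A) (hβ : 2 ≤ β)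
    (hAZ : ∀ z, 2 ≤ z → z < Z → (z + 1).Prime →
      A * siftDensity z * Real.log ((z + 1 : ℕ) : ℝ) ≤ 1)
    (hF : ∀ u v, 1 < u → u ≤ v → F v ≤ F u)
    (hf : ∀ u v, u ≤ v → f u ≤ f v) (hf0 : ∀ u, u ≤ β → f u = 0)
    (hFf : ∀ u v, 1 < u → u ≤ v → v * F v - u * F u ≤ (v - u) * f (v - 1))
    (hfF : ∀ u v, β < u → u ≤ v → (v - u) * F (v - 1) ≤ v * f v - u * f u)
    (hbF : ∀ u, 1 < u → 2 ≤ Real.exp (2 * u / A) * (F u - 1))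
    (hbf : ∀ u, β < u → 2 ≤ Real.exp (2 * u / A) * (1 - f u))
    (z : ℕ) (hz : 2 ≤ z) (hzZ : z ≤ Z) (α y : ℝ) (hα : 0 ≤ α) (hy : 0 < y) :
    (1 < A * siftDensity z * Real.log y →
      sifted z α y ≤ y * siftDensity z * F (A * siftDensity z * Real.log y)) ∧
    y * siftDensity z * f (A * siftDensity z * Real.log y) ≤ sifted z α y := by
  have hfnn : ∀ u, 0 ≤ f u := by
    intro u
    rcases le_total u β with h | h
    · rw [hf0 u h]
    · rw [← hf0 β le_rfl]; exact hf _ _ h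
  induction z, hz using Nat.le_induction generalizing α y with
  | base =>
    have h := abs_le.1 (abs_sifted_two_sub_le hα hy.le)
    rw [siftDensity_two] at h ⊢
    set u := A * (1 / 2) * Real.log y with hu
    have hexp : Real.exp (2 * u / A) = y := by
      rw [hu, show 2 * (A * (1 / 2) * Real.log y) / A = Real.log y by field_simp, Real.exp_log hy]
    constructor
    · intro h1
      have := hbF u h1
      rw [hexp] at this
      linarith
    · rcases le_or_gt u β with h1 | h1
      · rw [hf0 u h1, mul_zero]; exact sifted_nonneg _ _ _
      · have := hbf u h1
        rw [hexp] at this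
        linarith
  | succ z hz ih =>
    by_cases hp : (z + 1).Prime
    swap
    · rw [sifted_succ_of_not_prime hp, siftDensity_succ_of_not_prime hp]
      exact ih (by omega) α y hα hy
    set q : ℝ := ((z + 1 : ℕ) : ℝ) with hq
    have hq1 : 1 < q := by rw [hq]; exact_mod_cast hp.one_lt
    have hq0 : 0 < q := by linarith
    obtain ⟨h1, h2⟩ := ih (by omega) α y hα hy
    obtain ⟨h3, h4⟩ := ih (by omega) (α / q) (y / q) (by positivity) (by positivity)
    rw [sifted_succ_of_prime hp hα hy.le, siftDensity_succ_of_prime hp]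
    have hV := siftDensity_pos z
    set V := siftDensity z
    rw [Real.log_div hy.ne' hq0.ne'] at h3 h4
    have hAq : A * V * Real.log q ≤ 1 := hAZ z hz (by omega) hp
    set v := A * V * Real.log y with hv
    have e1 : A * (V * (1 - 1 / q)) * Real.log y = v * (1 - 1 / q) := by rw [hv]; ring
    have e2 : A * V * (Real.log y - Real.log q) = v - A * V * Real.log q := by rw [hv]; ring
    rw [e2] at h3 h4
    rw [e1]
    have hq' : 0 < 1 - 1 / q := by
      rw [sub_pos, div_lt_one hq0]; exact hq1
    have hw : v - 1 ≤ v - A * V * Real.log q := by linarith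
    set w := v - A * V * Real.log q
    set u := v * (1 - 1 / q) with hu
    have hvu : v - u = v / q := by rw [hu]; ring
    have hpos : ∀ t, 0 < t → t < u → 0 < v ∧ u ≤ v := by
      intro t ht htu
      have : 0 < v := by
        by_contra! hneg
        have : u ≤ 0 := by rw [hu]; exact mul_nonpos_of_nonpos_of_nonneg hneg hq'.le
        linarith
      refine ⟨this, ?_⟩
      have : 0 < v / q := by positivity
      linarith
    constructor
    · intro hu1
      obtain ⟨hv0, huv⟩ := hpos 1 one_pos hu1
      have g1 := h1 (by linarith)
      have g2 := hFf u v hu1 huv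
      have g3 : f (v - 1) ≤ f w := hf _ _ hw
      have g4 : y / q * V * f (v - 1) ≤ sifted z (α / q) (y / q) :=
        (mul_le_mul_of_nonneg_left g3 (by positivity)).trans h4
      have g5 : y * V / v * (v * F v - u * F u) ≤ y * V / v * ((v - u) * f (v - 1)) :=
        mul_le_mul_of_nonneg_left g2 (by positivity)
      have e3 : y * V / v * (v * F v - u * F u) =
          y * V * F v - y * (V * (1 - 1 / q)) * F u := by
        rw [hu]; field_simp
      have e4 : y * V / v * ((v - u) * f (v - 1)) = y / q * V * f (v - 1) := by
        rw [hvu]; field_simp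
      linarith
    · rcases le_or_gt u β with hu1 | hu1
      · rw [hf0 u hu1, mul_zero, ← sifted_succ_of_prime hp hα hy.le]
        exact sifted_nonneg _ _ _
      · obtain ⟨hv0, huv⟩ := hpos β (by linarith) hu1
        have g1 := hfF u v hu1 huv
        have g2 : F w ≤ F (v - 1) := hF _ _ (by linarith) hw
        have g3 := h3 (by linarith)
        have g4 : sifted z (α / q) (y / q) ≤ y / q * V * F (v - 1) :=
          g3.trans (mul_le_mul_of_nonneg_left g2 (by positivity))
        have g5 : y * V / v * ((v - u) * F (v - 1)) ≤ y * V / v * (v * f v - u * f u) :=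
          mul_le_mul_of_nonneg_left g1 (by positivity)
        have e3 : y * V / v * (v * f v - u * f u) =
            y * V * f v - y * (V * (1 - 1 / q)) * f u := by
          rw [hu]; field_simp
        have e4 : y * V / v * ((v - u) * F (v - 1)) = y / q * V * F (v - 1) := by
          rw [hvu]; field_simp
        linarith

/-! ### Explicit sieve functions -/

/-- The quintic used for the excess `u (F u - 1)` on the interval `[63/20, 103/20]`. -/
noncomputable def excessPoly (t : ℝ) : ℝ :=
  73 / 100 - t + 67 / 100 * t ^ 2 - 4 / 15 * t ^ 3 + 13 / 200 * t ^ 4 - 1 / 125 * t ^ 5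

/-- The excess `u (F u - 1)` of the upper sieve function. -/
noncomputable def upperExcess (u : ℝ) : ℝ :=
  if u ≤ 63 / 20 then 97 / 25 - u
  else if u ≤ 103 / 20 then excessPoly (u - 63 / 20)
  else 91 / 1500 * Real.exp (-(11 / 10) * (u - 103 / 20))

/-- The deficiency `u (1 - f u)` of the lower sieve function, for `u ≥ 43/20`. -/
noncomputable def lowerDefect (u : ℝ) : ℝ :=
  if u ≤ 83 / 20 then u - 97 / 25 * Real.log ((u - 1) / (23 / 20))
  else (83 / 20 - 97 / 25 * Real.log (63 / 23)) * Real.exp (-(11 / 10) * (u - 83 / 20))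

/-- The upper sieve function. -/
noncomputable def upperSieve (u : ℝ) : ℝ := 1 + upperExcess u / u

/-- The lower sieve function. -/
noncomputable def lowerSieve (u : ℝ) : ℝ := if u ≤ 43 / 20 then 0 else 1 - lowerDefect u / u

lemma one_le_log_div : 1 ≤ Real.log (63 / 23) := by
  rw [Real.le_log_iff_exp_le (by norm_num)]
  have := Real.exp_one_lt_d9
  norm_num at this ⊢
  linarith

lemma log_div_le : Real.log (63 / 23) ≤ 1009 / 1000 := by
  rw [Real.log_le_iff_le_exp (by norm_num), show (1009 / 1000 : ℝ) = 1 + 9 / 1000 by norm_num,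
    Real.exp_add]
  have h1 := Real.exp_one_gt_d9
  have h2 := Real.add_one_le_exp (9 / 1000 : ℝ)
  nlinarith

lemma upperExcess_of_le {u : ℝ} (h : u ≤ 63 / 20) : upperExcess u = 97 / 25 - u := if_pos h

lemma upperExcess_of_mem {u : ℝ} (h1 : 63 / 20 ≤ u) (h2 : u ≤ 103 / 20) :
    upperExcess u = excessPoly (u - 63 / 20) := by
  unfold upperExcess
  split_ifs with h
  · obtain rfl : u = 63 / 20 := le_antisymm h h1
    norm_num [excessPoly]
  · rfl

lemma upperExcess_of_ge {u : ℝ} (h1 : 103 / 20 ≤ u) :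
    upperExcess u = 91 / 1500 * Real.exp (-(11 / 10) * (u - 103 / 20)) := by
  unfold upperExcess
  split_ifs with h h'
  · linarith
  · obtain rfl : u = 103 / 20 := le_antisymm h' h1
    norm_num [excessPoly]
  · rfl

lemma lowerDefect_of_le {u : ℝ} (h : u ≤ 83 / 20) :
    lowerDefect u = u - 97 / 25 * Real.log ((u - 1) / (23 / 20)) := if_pos h

lemma lowerDefect_of_ge {u : ℝ} (h1 : 83 / 20 ≤ u) :
    lowerDefect u = (83 / 20 - 97 / 25 * Real.log (63 / 23)) *
      Real.exp (-(11 / 10) * (u - 83 / 20)) := by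
  unfold lowerDefect
  split_ifs with h
  · obtain rfl : u = 83 / 20 := le_antisymm h h1
    norm_num
  · rfl

lemma lowerDefect_const_bounds : 47 / 200 ≤ 83 / 20 - 97 / 25 * Real.log (63 / 23) ∧
    83 / 20 - 97 / 25 * Real.log (63 / 23) ≤ 27 / 100 := by
  have h1 := one_le_log_div
  have h2 := log_div_le
  constructor <;> linarith

/-- A mean value bound for a function agreeing with a differentiable one on `[a, b]`. -/
lemma sub_le_of_hasDerivAt_le {φ ψ ψ' : ℝ → ℝ} {u v C : ℝ} (huv : u ≤ v)
    (hφ : ∀ t, u ≤ t → t ≤ v → φ t = ψ t) (hψ : ∀ t, u ≤ t → t ≤ v → HasDerivAt ψ (ψ' t) t)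
    (hC : ∀ t, u < t → t < v → ψ' t ≤ C) : φ v - φ u ≤ C * (v - u) := by
  rw [hφ v huv le_rfl, hφ u le_rfl huv]
  refine Convex.image_sub_le_mul_sub_of_deriv_le (convex_Icc u v)
    (fun t ht => (hψ t ht.1 ht.2).continuousAt.continuousWithinAt)
    (fun t ht => ?_) (fun t ht => ?_) u ⟨le_rfl, huv⟩ v ⟨huv, le_rfl⟩ huv
  · rw [interior_Icc] at ht
    exact (hψ t ht.1.le ht.2.le).differentiableAt.differentiableWithinAt
  · rw [interior_Icc] at ht
    rw [(hψ t ht.1.le ht.2.le).deriv]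
    exact hC t ht.1 ht.2

lemma hasDerivAt_lowerDefect_log {t : ℝ} (ht : 1 < t) :
    HasDerivAt (fun u : ℝ => u - 97 / 25 * Real.log ((u - 1) / (23 / 20)))
      (1 - 97 / 25 / (t - 1)) t := by
  have h1 : HasDerivAt (fun u : ℝ => (u - 1) / (23 / 20)) (1 / (23 / 20)) t :=
    ((hasDerivAt_id t).sub_const 1).div_const _
  have h2 : (t - 1) / (23 / 20) ≠ 0 := by
    have : 0 < t - 1 := by linarith
    positivity
  have h3 := (hasDerivAt_id t).sub ((h1.log h2).const_mul (97 / 25))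
  refine h3.congr_deriv ?_
  have : t - 1 ≠ 0 := by linarith
  field_simp

lemma hasDerivAt_exp_tail (K c t : ℝ) :
    HasDerivAt (fun u : ℝ => K * Real.exp (-(11 / 10) * (u - c)))
      (-(11 / 10) * (K * Real.exp (-(11 / 10) * (t - c)))) t := by
  have h1 : HasDerivAt (fun u : ℝ => -(11 / 10) * (u - c)) (-(11 / 10) * 1) t :=
    ((hasDerivAt_id t).sub_const c).const_mul _
  refine (h1.exp.const_mul K).congr_deriv ?_
  ring

lemma hasDerivAt_excessPoly (t : ℝ) :
    HasDerivAt (fun u : ℝ => excessPoly (u - 63 / 20))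
      (-(1 - 67 / 50 * (t - 63 / 20) + 4 / 5 * (t - 63 / 20) ^ 2 - 13 / 50 * (t - 63 / 20) ^ 3
        + 1 / 25 * (t - 63 / 20) ^ 4)) t := by
  have h0 : HasDerivAt (fun u : ℝ => u - 63 / 20) 1 t := (hasDerivAt_id t).sub_const _
  unfold excessPoly
  have h := ((((((hasDerivAt_const t (73 / 100 : ℝ)).sub h0).add ((h0.pow 2).const_mul
    (67 / 100))).sub ((h0.pow 3).const_mul (4 / 15))).add ((h0.pow 4).const_mul (13 / 200))).sub
    ((h0.pow 5).const_mul (1 / 125)))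
  refine h.congr_deriv ?_
  norm_num
  ring

lemma lowerDefect_antitone {u v : ℝ} (hu : 43 / 20 ≤ u) (huv : u ≤ v) :
    lowerDefect v ≤ lowerDefect u := by
  have hc := lowerDefect_const_bounds
  have h1 : ∀ u v, 43 / 20 ≤ u → u ≤ v → v ≤ 83 / 20 → lowerDefect v ≤ lowerDefect u := by
    intro u v hu huv hv
    have := sub_le_of_hasDerivAt_le (φ := lowerDefect) (C := 0) huv
      (fun t _ h => lowerDefect_of_le (h.trans hv))
      (fun t h _ => hasDerivAt_lowerDefect_log (by linarith))
      (fun t h h' => by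
        rw [sub_nonpos, le_div_iff₀ (by linarith)]; linarith)
    linarith
  have h2 : ∀ u v, 83 / 20 ≤ u → u ≤ v → lowerDefect v ≤ lowerDefect u := by
    intro u v hu huv
    rw [lowerDefect_of_ge hu, lowerDefect_of_ge (hu.trans huv)]
    refine mul_le_mul_of_nonneg_left (Real.exp_le_exp.2 ?_) (by linarith)
    linarith
  rcases le_total v (83 / 20) with h | h
  · exact h1 u v hu huv h
  · rcases le_total u (83 / 20) with h' | h'
    · exact (h2 _ v le_rfl h).trans (h1 u _ hu h' le_rfl)
    · exact h2 u v h' huv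

lemma lowerDefect_pos {u : ℝ} (hu : 43 / 20 ≤ u) : 0 < lowerDefect u := by
  have hc := lowerDefect_const_bounds
  refine lt_of_lt_of_le ?_ (lowerDefect_antitone hu (le_max_left u (83 / 20)))
  rw [lowerDefect_of_ge (le_max_right _ _)]
  have : 0 < 83 / 20 - 97 / 25 * Real.log (63 / 23) := by linarith
  positivity

lemma lowerDefect_lt {u : ℝ} (hu : 43 / 20 < u) : lowerDefect u < u := by
  have h := lowerDefect_antitone le_rfl hu.le
  rw [lowerDefect_of_le (u := 43 / 20) (by norm_num)] at h
  norm_num at h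
  linarith

lemma lowerSieve_of_le {u : ℝ} (hu : u ≤ 43 / 20) : lowerSieve u = 0 := if_pos hu

lemma lowerSieve_of_lt {u : ℝ} (hu : 43 / 20 < u) : lowerSieve u = 1 - lowerDefect u / u :=
  if_neg (not_le.2 hu)

lemma lowerSieve_pos {u : ℝ} (hu : 43 / 20 < u) : 0 < lowerSieve u := by
  rw [lowerSieve_of_lt hu, sub_pos, div_lt_one (by linarith)]
  exact lowerDefect_lt hu

lemma lowerSieve_monotone {u v : ℝ} (huv : u ≤ v) : lowerSieve u ≤ lowerSieve v := by
  rcases le_or_gt u (43 / 20) with h | h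
  · rw [lowerSieve_of_le h]
    rcases le_or_gt v (43 / 20) with h' | h'
    · rw [lowerSieve_of_le h']
    · exact (lowerSieve_pos h').le
  · rw [lowerSieve_of_lt h, lowerSieve_of_lt (h.trans_le huv)]
    have h1 := lowerDefect_antitone h.le huv
    have h2 := lowerDefect_pos h.le
    have : lowerDefect v / v ≤ lowerDefect u / u :=
      div_le_div₀ h2.le h1 (by linarith) huv
    linarith

lemma lowerSieve_le_one (u : ℝ) : lowerSieve u ≤ 1 := by
  rcases le_or_gt u (43 / 20) with h | h
  · rw [lowerSieve_of_le h]; norm_num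
  · rw [lowerSieve_of_lt h]
    have : 0 < lowerDefect u / u := div_pos (lowerDefect_pos h.le) (by linarith)
    linarith

lemma excess_deriv_bound {t : ℝ} (h0 : 0 < t) (h2 : t < 2) :
    1 - 97 / 25 * Real.log ((43 / 20 + t - 1) / (23 / 20)) / (43 / 20 + t) ≤
      1 - 67 / 50 * t + 4 / 5 * t ^ 2 - 13 / 50 * t ^ 3 + 1 / 25 * t ^ 4 := by
  have h23 : 0 < 23 / 10 + t := by linarith
  have hlog := Real.sum_range_le_log_div (x := t / (23 / 10 + t)) (by positivity)
    (by rw [div_lt_one h23]; linarith) 3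
  have e : (1 + t / (23 / 10 + t)) / (1 - t / (23 / 10 + t)) = (43 / 20 + t - 1) / (23 / 20) := by
    have : 1 - t / (23 / 10 + t) ≠ 0 := by
      rw [one_sub_div h23.ne']
      have : 23 / 10 + t - t ≠ 0 := by linarith
      positivity
    field_simp
    ring
  rw [e] at hlog
  simp only [Finset.sum_range_succ, Finset.sum_range_zero] at hlog
  norm_num at hlog
  set D := 23 / 10 + t with hD
  have hQ : 0 ≤ 194 / 25 * (D ^ 4 + t ^ 2 * D ^ 2 / 3 + t ^ 4 / 5) -
      (43 / 20 + t) * (67 / 50 - 4 / 5 * t + 13 / 50 * t ^ 2 - 1 / 25 * t ^ 3) * D ^ 5 := by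
    rcases le_total t 1 with h | h
    · have hb : ∀ i j, 0 ≤ t ^ i * (1 - t) ^ j := fun i j =>
        mul_nonneg (pow_nonneg h0.le i) (pow_nonneg (by linarith) j)
      rw [hD]
      linarith [hb 0 9, hb 1 8, hb 2 7, hb 3 6, hb 4 5, hb 5 4, hb 6 3, hb 7 2, hb 8 1, hb 9 0]
    · have hb : ∀ i j, 0 ≤ (t - 1) ^ i * (2 - t) ^ j := fun i j =>
        mul_nonneg (pow_nonneg (by linarith) i) (pow_nonneg (by linarith) j)
      rw [hD]
      linarith [hb 0 9, hb 1 8, hb 2 7, hb 3 6, hb 4 5, hb 5 4, hb 6 3, hb 7 2, hb 8 1, hb 9 0]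
  have hQ' : (43 / 20 + t) * (67 / 50 * t - 4 / 5 * t ^ 2 + 13 / 50 * t ^ 3 - 1 / 25 * t ^ 4) ≤
      194 / 25 * (t / D + (t / D) ^ 3 / 3 + (t / D) ^ 5 / 5) := by
    have h3 := mul_nonneg h0.le (div_nonneg hQ (pow_nonneg h23.le 5))
    have e3 : t * ((194 / 25 * (D ^ 4 + t ^ 2 * D ^ 2 / 3 + t ^ 4 / 5) -
      (43 / 20 + t) * (67 / 50 - 4 / 5 * t + 13 / 50 * t ^ 2 - 1 / 25 * t ^ 3) * D ^ 5) / D ^ 5) =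
      194 / 25 * (t / D + (t / D) ^ 3 / 3 + (t / D) ^ 5 / 5) - (43 / 20 + t) *
      (67 / 50 * t - 4 / 5 * t ^ 2 + 13 / 50 * t ^ 3 - 1 / 25 * t ^ 4) := by
      clear_value D
      field_simp
    linarith
  have h4 : 67 / 50 * t - 4 / 5 * t ^ 2 + 13 / 50 * t ^ 3 - 1 / 25 * t ^ 4 ≤
      97 / 25 * Real.log ((43 / 20 + t - 1) / (23 / 20)) / (43 / 20 + t) := by
    rw [le_div_iff₀ (by linarith)]
    linarith
  linarith

lemma upperExcess_sub_le {u v : ℝ} (hu : 1 < u) (huv : u ≤ v) :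
    upperExcess v - upperExcess u ≤ (v - u) * (lowerSieve (v - 1) - 1) := by
  have hc := lowerDefect_const_bounds
  have h1 : ∀ u v, 1 < u → u ≤ v → v ≤ 63 / 20 →
      upperExcess v - upperExcess u ≤ (v - u) * (lowerSieve (v - 1) - 1) := by
    intro u v hu huv hv
    rw [upperExcess_of_le hv, upperExcess_of_le (huv.trans hv), lowerSieve_of_le (by linarith)]
    linarith
  have h2 : ∀ u v, 63 / 20 ≤ u → u ≤ v → v ≤ 103 / 20 →
      upperExcess v - upperExcess u ≤ (v - u) * (lowerSieve (v - 1) - 1) := by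
    intro u v hu huv hv
    rw [mul_comm]
    refine sub_le_of_hasDerivAt_le huv
      (fun t h h' => upperExcess_of_mem (hu.trans h) (h'.trans hv))
      (fun t _ _ => hasDerivAt_excessPoly t) (fun t h h' => ?_)
    have hm := lowerSieve_monotone (show t - 1 ≤ v - 1 by linarith)
    have hb := excess_deriv_bound (t := t - 63 / 20) (by linarith) (by linarith)
    rw [lowerSieve_of_lt (show 43 / 20 < t - 1 by linarith),
      lowerDefect_of_le (show t - 1 ≤ 83 / 20 by linarith)] at hm
    rw [show 43 / 20 + (t - 63 / 20) = t - 1 by ring] at hb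
    rw [sub_div, div_self (by linarith)] at hm
    linarith
  have h3 : ∀ u v, 103 / 20 ≤ u → u ≤ v →
      upperExcess v - upperExcess u ≤ (v - u) * (lowerSieve (v - 1) - 1) := by
    intro u v hu huv
    rw [mul_comm]
    refine sub_le_of_hasDerivAt_le huv (fun t h _ => upperExcess_of_ge (hu.trans h))
      (fun t _ _ => hasDerivAt_exp_tail _ _ t) (fun t h h' => ?_)
    have hm := lowerSieve_monotone (show t - 1 ≤ v - 1 by linarith)
    rw [lowerSieve_of_lt (show 43 / 20 < t - 1 by linarith),
      lowerDefect_of_ge (show 83 / 20 ≤ t - 1 by linarith),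
      show t - 1 - 83 / 20 = t - 103 / 20 by ring] at hm
    have hb : (83 / 20 - 97 / 25 * Real.log (63 / 23)) / (t - 1) ≤ 11 / 10 * (91 / 1500) := by
      rw [div_le_iff₀ (by linarith)]
      linarith
    have hb' := mul_le_mul_of_nonneg_right hb (Real.exp_pos (-(11 / 10) * (t - 103 / 20))).le
    rw [div_mul_eq_mul_div] at hb'
    linarith
  have glue : ∀ m, u ≤ m → m ≤ v →
      upperExcess m - upperExcess u ≤ (m - u) * (lowerSieve (m - 1) - 1) →
      upperExcess v - upperExcess m ≤ (v - m) * (lowerSieve (v - 1) - 1) →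
      upperExcess v - upperExcess u ≤ (v - u) * (lowerSieve (v - 1) - 1) := by
    intro m hm hm' hl hr
    have := mul_le_mul_of_nonneg_left
      (lowerSieve_monotone (show m - 1 ≤ v - 1 by linarith)) (sub_nonneg.2 hm)
    linarith
  rcases le_total v (63 / 20) with hv | hv
  · exact h1 u v hu huv hv
  rcases le_total (103 / 20) u with hu3 | hu3
  · exact h3 u v hu3 huv
  have h12 : ∀ v, u ≤ v → 63 / 20 ≤ v → v ≤ 103 / 20 →
      upperExcess v - upperExcess u ≤ (v - u) * (lowerSieve (v - 1) - 1) := by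
    intro v huv hv hv'
    rcases le_total (63 / 20) u with hu2 | hu2
    · exact h2 u v hu2 huv hv'
    · have := mul_le_mul_of_nonneg_left
        (lowerSieve_monotone (show 63 / 20 - 1 ≤ v - 1 by linarith)) (sub_nonneg.2 hu2)
      have hl := h1 u _ hu hu2 le_rfl
      have hr := h2 _ v le_rfl hv hv'
      linarith
  rcases le_total v (103 / 20) with hv3 | hv3
  · exact h12 v huv hv hv3
  · exact glue _ hu3 hv3 (h12 _ hu3 (by norm_num) le_rfl) (h3 _ v le_rfl hv3)

lemma upperExcess_antitone {u v : ℝ} (hu : 1 < u) (huv : u ≤ v) :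
    upperExcess v ≤ upperExcess u := by
  have h1 := upperExcess_sub_le hu huv
  have h2 := mul_nonneg (sub_nonneg.2 huv) (sub_nonneg.2 (lowerSieve_le_one (v - 1)))
  linarith

lemma upperExcess_pos {u : ℝ} (hu : 1 < u) : 0 < upperExcess u := by
  refine lt_of_lt_of_le ?_ (upperExcess_antitone hu (le_max_left u (103 / 20)))
  rw [upperExcess_of_ge (le_max_right _ _)]
  positivity

lemma upperExcess_div_antitone {u v : ℝ} (hu : 1 < u) (huv : u ≤ v) :
    upperExcess v / v ≤ upperExcess u / u :=
  div_le_div₀ (upperExcess_pos hu).le (upperExcess_antitone hu huv) (by linarith) huv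

lemma upperSieve_antitone {u v : ℝ} (hu : 1 < u) (huv : u ≤ v) :
    upperSieve v ≤ upperSieve u :=
  add_le_add_right (upperExcess_div_antitone hu huv) 1

lemma mul_upperSieve_sub_le {u v : ℝ} (hu : 1 < u) (huv : u ≤ v) :
    v * upperSieve v - u * upperSieve u ≤ (v - u) * lowerSieve (v - 1) := by
  have h := upperExcess_sub_le hu huv
  have e : ∀ u : ℝ, 1 < u → u * upperSieve u = u + upperExcess u := fun u hu => by
    rw [upperSieve, mul_add, mul_div_cancel₀ _ (by linarith), mul_one]
  rw [e u hu, e v (by linarith)]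
  linarith

lemma excessPoly_le_exp {t : ℝ} (h0 : 0 ≤ t) (h2 : t ≤ 2) :
    excessPoly t ≤ 517 / 2000 * (63 / 20 + t) * Real.exp (-(11 / 10) * t) := by
  unfold excessPoly
  rcases le_total t (9 / 5) with h | h
  · have he : (1 - 11 / 40 * t) ^ 4 ≤ Real.exp (-(11 / 10) * t) := by
      have := Real.one_sub_div_pow_le_exp_neg (n := 4) (t := 11 / 10 * t)
        (by norm_num; linarith)
      convert this using 2
      · push_cast; ring
      · ring
    refine le_trans ?_ (mul_le_mul_of_nonneg_left he (by positivity))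
    rcases le_total t 1 with h' | h'
    · have hb : ∀ i j, 0 ≤ t ^ i * (1 - t) ^ j := fun i j =>
        mul_nonneg (pow_nonneg h0 i) (pow_nonneg (by linarith) j)
      linarith [hb 0 5, hb 1 4, hb 2 3, hb 3 2, hb 4 1, hb 5 0]
    · have hb : ∀ i j, 0 ≤ (t - 1) ^ i * (9 / 5 - t) ^ j := fun i j =>
        mul_nonneg (pow_nonneg (by linarith) i) (pow_nonneg (by linarith) j)
      linarith [hb 0 5, hb 1 4, hb 2 3, hb 3 2, hb 4 1, hb 5 0]
  · have he : (29 / 40) ^ 8 ≤ Real.exp (-(11 / 10) * t) := by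
      have := Real.one_sub_div_pow_le_exp_neg (n := 8) (t := 11 / 5) (by norm_num)
      norm_num at this ⊢
      refine this.trans (Real.exp_le_exp.2 (by linarith))
    refine le_trans ?_ (mul_le_mul_of_nonneg_left he (by positivity))
    have hb : ∀ i j, 0 ≤ (t - 9 / 5) ^ i * (2 - t) ^ j := fun i j =>
      mul_nonneg (pow_nonneg (by linarith) i) (pow_nonneg (by linarith) j)
    linarith [hb 0 5, hb 1 4, hb 2 3, hb 3 2, hb 4 1, hb 5 0]

lemma lowerDefect_sub_le {u v : ℝ} (hu : 43 / 20 ≤ u) (huv : u ≤ v) :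
    lowerDefect v - lowerDefect u ≤ (v - u) * (-(upperExcess (v - 1) / (v - 1))) := by
  have hc := lowerDefect_const_bounds
  have h1 : ∀ u v, 43 / 20 ≤ u → u ≤ v → v ≤ 83 / 20 →
      lowerDefect v - lowerDefect u ≤ (v - u) * (-(upperExcess (v - 1) / (v - 1))) := by
    intro u v hu huv hv
    rw [mul_comm]
    refine sub_le_of_hasDerivAt_le huv (fun t _ h => lowerDefect_of_le (h.trans hv))
      (fun t h _ => hasDerivAt_lowerDefect_log (by linarith)) (fun t h h' => ?_)
    have hm := upperExcess_div_antitone (show 1 < t - 1 by linarith)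
      (show t - 1 ≤ v - 1 by linarith)
    rw [upperExcess_of_le (show t - 1 ≤ 63 / 20 by linarith), sub_div,
      div_self (show t - 1 ≠ 0 by linarith)] at hm
    linarith
  have h2 : ∀ u v, 83 / 20 ≤ u → u ≤ v →
      lowerDefect v - lowerDefect u ≤ (v - u) * (-(upperExcess (v - 1) / (v - 1))) := by
    intro u v hu huv
    rw [mul_comm]
    refine sub_le_of_hasDerivAt_le huv (fun t h _ => lowerDefect_of_ge (hu.trans h))
      (fun t _ _ => hasDerivAt_exp_tail _ _ t) (fun t h h' => ?_)
    have hm := upperExcess_div_antitone (show 1 < t - 1 by linarith)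
      (show t - 1 ≤ v - 1 by linarith)
    have hX : upperExcess (t - 1) ≤ 517 / 2000 * (t - 1) * Real.exp (-(11 / 10) * (t - 83 / 20)) := by
      rcases le_total t (123 / 20) with h6 | h6
      · have := excessPoly_le_exp (t := t - 83 / 20) (by linarith) (by linarith)
        rw [upperExcess_of_mem (by linarith) (by linarith),
          show t - 1 - 63 / 20 = t - 83 / 20 by ring]
        rwa [show 63 / 20 + (t - 83 / 20) = t - 1 by ring] at this
      · rw [upperExcess_of_ge (by linarith), show -(11 / 10) * (t - 1 - 103 / 20) =
          11 / 5 + -(11 / 10) * (t - 83 / 20) by ring, Real.exp_add, ← mul_assoc]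
        refine mul_le_mul_of_nonneg_right ?_ (Real.exp_pos _).le
        have h3 : Real.exp (11 / 5) ≤ 21 := by
          calc Real.exp (11 / 5) ≤ Real.exp ((3 : ℕ) * 1) := Real.exp_le_exp.2 (by norm_num)
            _ = Real.exp 1 ^ 3 := Real.exp_nat_mul _ _
            _ ≤ (2.75 : ℝ) ^ 3 := by
              gcongr
              have := Real.exp_one_lt_d9
              norm_num at this ⊢
              linarith
            _ ≤ 21 := by norm_num
        linarith
    have hX' : upperExcess (t - 1) / (t - 1) ≤
        517 / 2000 * Real.exp (-(11 / 10) * (t - 83 / 20)) := by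
      rw [div_le_iff₀ (by linarith)]
      linarith
    have h5 := mul_le_mul_of_nonneg_right hc.1 (Real.exp_pos (-(11 / 10) * (t - 83 / 20))).le
    linarith
  rcases le_total v (83 / 20) with hv | hv
  · exact h1 u v hu huv hv
  rcases le_total (83 / 20) u with hu' | hu'
  · exact h2 u v hu' huv
  have := mul_le_mul_of_nonneg_left (upperExcess_div_antitone
    (show 1 < (83 / 20 : ℝ) - 1 by norm_num) (show 83 / 20 - 1 ≤ v - 1 by linarith))
    (sub_nonneg.2 hu')
  have hl := h1 u _ hu hu' le_rfl
  have hr := h2 _ v le_rfl hv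
  linarith

lemma le_mul_lowerSieve_sub {u v : ℝ} (hu : 43 / 20 < u) (huv : u ≤ v) :
    (v - u) * upperSieve (v - 1) ≤ v * lowerSieve v - u * lowerSieve u := by
  have h := lowerDefect_sub_le hu.le huv
  have e : ∀ u : ℝ, 43 / 20 < u → u * lowerSieve u = u - lowerDefect u := fun u hu => by
    rw [lowerSieve_of_lt hu, mul_sub, mul_div_cancel₀ _ (by linarith), mul_one]
  rw [e u hu, e v (by linarith), upperSieve]
  linarith

lemma pow_mul_le_exp (n : ℕ) {x : ℝ} (hx : (n : ℝ) - 1 ≤ x) :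
    (2718 / 1000 : ℝ) ^ n * (1 + (x - n)) ≤ Real.exp x := by
  have h1 : (2718 / 1000 : ℝ) ^ n ≤ Real.exp n := by
    rw [← Real.exp_one_pow]
    have := Real.exp_one_gt_d9
    gcongr
    norm_num at this ⊢
    linarith
  calc (2718 / 1000 : ℝ) ^ n * (1 + (x - n)) ≤ Real.exp n * Real.exp (x - n) := by
        refine mul_le_mul h1 ?_ (by linarith) (Real.exp_pos _).le
        linarith [Real.add_one_le_exp (x - n)]
    _ = Real.exp x := by rw [← Real.exp_add]; ring_nf

lemma two_mul_le_of_antitone {X : ℝ → ℝ} {u a b c e : ℝ} (ha : a ≤ u) (hb : u ≤ b)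
    (hX : X b ≤ X u) (hc : c ≤ X b) (hc0 : 0 < c) (he : e ≤ Real.exp (29 / 25 * a))
    (h : 2 * b ≤ c * e) : 2 * u ≤ X u * Real.exp (29 / 25 * u) := by
  have h1 : Real.exp (29 / 25 * a) ≤ Real.exp (29 / 25 * u) := Real.exp_le_exp.2 (by linarith)
  have h2 : c * e ≤ X u * Real.exp (29 / 25 * u) :=
    (mul_le_mul_of_nonneg_left (he.trans h1) hc0.le).trans
      (mul_le_mul_of_nonneg_right (hc.trans hX) (Real.exp_pos _).le)
  linarith

lemma two_mul_le_of_tail {K c d u : ℝ} (hd : 0 ≤ d) (hu : u = c + d) (hc : c ≤ 103 / 20)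
    (hK : 18 ≤ K * Real.exp (29 / 25 * c)) :
    2 * u ≤ K * Real.exp (-(11 / 10) * (u - c)) * Real.exp (29 / 25 * u) := by
  have e1 : K * Real.exp (-(11 / 10) * (u - c)) * Real.exp (29 / 25 * u) =
      K * Real.exp (29 / 25 * c) * Real.exp (3 / 50 * d) := by
    rw [mul_assoc, mul_assoc, ← Real.exp_add, ← Real.exp_add, hu]
    ring_nf
  have h2 := Real.quadratic_le_exp_of_nonneg (show 0 ≤ 3 / 50 * d by positivity)
  rw [e1]
  have h3 : 18 * (1 + 3 / 50 * d + (3 / 50 * d) ^ 2 / 2) ≤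
      K * Real.exp (29 / 25 * c) * Real.exp (3 / 50 * d) :=
    mul_le_mul hK h2 (by positivity) (by linarith)
  nlinarith [sq_nonneg (d - 14)]

lemma two_mul_le_upperExcess {u : ℝ} (hu : 1 < u) :
    2 * u ≤ upperExcess u * Real.exp (29 / 25 * u) := by
  rcases le_total u (63 / 20) with h1 | h1
  · rw [upperExcess_of_le h1]
    have h2 := Real.quadratic_le_exp_of_nonneg (show 0 ≤ 29 / 25 * u by linarith)
    refine le_trans ?_ (mul_le_mul_of_nonneg_left h2 (by linarith))
    have hb : ∀ i j, 0 ≤ (u - 1) ^ i * (63 / 20 - u) ^ j := fun i j =>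
      mul_nonneg (pow_nonneg (by linarith) i) (pow_nonneg (by linarith) j)
    linarith [hb 0 3, hb 1 2, hb 2 1, hb 3 0]
  rcases le_total u (73 / 20) with h2 | h2
  · refine two_mul_le_of_antitone (c := 36 / 100) h1 h2 (upperExcess_antitone hu h2) ?_
      (by norm_num) (pow_mul_le_exp 3 (by norm_num)) (by norm_num)
    rw [upperExcess_of_mem (by norm_num) (by norm_num)]
    norm_num [excessPoly]
  rcases le_total u (83 / 20) with h3 | h3
  · refine two_mul_le_of_antitone (c := 18 / 100) h2 h3 (upperExcess_antitone hu h3) ?_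
      (by norm_num) (pow_mul_le_exp 4 (by norm_num)) (by norm_num)
    rw [upperExcess_of_mem (by norm_num) (by norm_num)]
    norm_num [excessPoly]
  rcases le_total u (93 / 20) with h4 | h4
  · refine two_mul_le_of_antitone (c := 10 / 100) h3 h4 (upperExcess_antitone hu h4) ?_
      (by norm_num) (pow_mul_le_exp 4 (by norm_num)) (by norm_num)
    rw [upperExcess_of_mem (by norm_num) (by norm_num)]
    norm_num [excessPoly]
  rcases le_total u (103 / 20) with h5 | h5
  · refine two_mul_le_of_antitone (c := 6 / 100) h4 h5 (upperExcess_antitone hu h5) ?_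
      (by norm_num) (pow_mul_le_exp 5 (by norm_num)) (by norm_num)
    rw [upperExcess_of_mem (by norm_num) (by norm_num)]
    norm_num [excessPoly]
  rw [upperExcess_of_ge h5]
  refine two_mul_le_of_tail (d := u - 103 / 20) (by linarith) (by ring) le_rfl ?_
  have := pow_mul_le_exp 6 (x := 29 / 25 * (103 / 20)) (by norm_num)
  refine le_trans ?_ (mul_le_mul_of_nonneg_left this (by norm_num))
  norm_num

lemma two_mul_le_lowerDefect {u : ℝ} (hu : 43 / 20 < u) :
    2 * u ≤ lowerDefect u * Real.exp (29 / 25 * u) := by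
  have hc := lowerDefect_const_bounds
  rcases le_total u (16 / 5) with h1 | h1
  · refine two_mul_le_of_antitone (c := 63 / 100) hu.le h1 (lowerDefect_antitone hu.le h1) ?_
      (by norm_num) (pow_mul_le_exp 2 (by norm_num)) (by norm_num)
    rw [lowerDefect_of_le (by norm_num)]
    have hl : Real.log ((16 / 5 - 1) / (23 / 20)) ≤ 66 / 100 := by
      rw [Real.log_le_iff_le_exp (by norm_num)]
      have h2 := Real.quadratic_le_exp_of_nonneg (show (0 : ℝ) ≤ 33 / 100 by norm_num)
      rw [show (66 / 100 : ℝ) = 33 / 100 + 33 / 100 by norm_num, Real.exp_add]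
      nlinarith
    linarith
  rcases le_total u (83 / 20) with h2 | h2
  · refine two_mul_le_of_antitone (c := 235 / 1000) h1 h2 (lowerDefect_antitone hu.le h2) ?_
      (by norm_num) (pow_mul_le_exp 4 (by norm_num)) (by norm_num)
    rw [lowerDefect_of_ge le_rfl]
    norm_num
    linarith
  rw [lowerDefect_of_ge h2]
  refine two_mul_le_of_tail (d := u - 83 / 20) (by linarith) (by ring) (by norm_num) ?_
  have := pow_mul_le_exp 5 (x := 29 / 25 * (83 / 20)) (by norm_num)
  refine le_trans ?_ (mul_le_mul hc.1 this (by norm_num) (by linarith))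
  norm_num

lemma exp_le_exp_two_mul_div {A u : ℝ} (hA0 : 0 < A) (hA : A ≤ 43 / 25) (hu : 0 ≤ u) :
    Real.exp (29 / 25 * u) ≤ Real.exp (2 * u / A) := by
  refine Real.exp_le_exp.2 ?_
  rw [le_div_iff₀ hA0]
  nlinarith

lemma two_le_exp_mul_upperSieve {A u : ℝ} (hA0 : 0 < A) (hA : A ≤ 43 / 25) (hu : 1 < u) :
    2 ≤ Real.exp (2 * u / A) * (upperSieve u - 1) := by
  have h1 := two_mul_le_upperExcess hu
  have h2 := mul_le_mul_of_nonneg_left (exp_le_exp_two_mul_div hA0 hA (by linarith : 0 ≤ u))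
    (upperExcess_pos hu).le
  rw [upperSieve, add_sub_cancel_left, ← mul_div_assoc, le_div_iff₀ (by linarith)]
  linarith

lemma two_le_exp_mul_lowerSieve {A u : ℝ} (hA0 : 0 < A) (hA : A ≤ 43 / 25) (hu : 43 / 20 < u) :
    2 ≤ Real.exp (2 * u / A) * (1 - lowerSieve u) := by
  have h1 := two_mul_le_lowerDefect hu
  have h2 := mul_le_mul_of_nonneg_left (exp_le_exp_two_mul_div hA0 hA (by linarith : 0 ≤ u))
    (lowerDefect_pos hu.le).le
  rw [lowerSieve_of_lt hu, sub_sub_cancel, ← mul_div_assoc, le_div_iff₀ (by linarith)]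
  linarith

/-- A consequence of the linear sieve: long intervals contain integers without small prime
factors. -/
lemma sifted_pos_of_lt {A : ℝ} (hA0 : 0 < A) (hA : A ≤ 43 / 25) {z : ℕ} (hz : 2 ≤ z)
    (hAz : ∀ p ≤ z, 3 ≤ p → p.Prime → A * siftDensity (p - 1) * Real.log p ≤ 1)
    {α y : ℝ} (hα : 0 ≤ α) (hy : 0 < y) (hpos : 43 / 20 < A * siftDensity z * Real.log y) :
    0 < sifted z α y := by
  have h := (linear_sieve (Z := z) hA0 (by norm_num : (2 : ℝ) ≤ 43 / 20)
    (fun w hw hwz hp => hAz (w + 1) hwz (by omega) hp)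
    (fun u v => upperSieve_antitone) (fun u v => lowerSieve_monotone)
    (fun u => lowerSieve_of_le) (fun u v => mul_upperSieve_sub_le)
    (fun u v => le_mul_lowerSieve_sub) (fun u => two_le_exp_mul_upperSieve hA0 hA)
    (fun u => two_le_exp_mul_lowerSieve hA0 hA) z hz le_rfl α y hα hy).2
  exact lt_of_lt_of_le (mul_pos (mul_pos hy (siftDensity_pos z)) (lowerSieve_pos hpos)) h

/-! ### A combined Legendre and Bonferroni sieve for small sifting ranges -/

lemma lt_sifted_of_sum_inv {z r : ℕ} (hz : 2 ≤ z) (hzr : z ≤ r) {α y : ℝ} (hα : 0 ≤ α)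
    (hy : 0 ≤ y) :
    y * siftDensity z * (1 - ∑ p ∈ (Finset.Ioc z r).filter Nat.Prime, (1 / p : ℝ)) -
      2 ^ (Nat.primeCounting z - 1) *
        (1 + ((Finset.Ioc z r).filter Nat.Prime).card) ≤ sifted r α y := by
  have h1 := sifted_sub_sum_le hzr hα hy
  have h2 := (abs_le.1 (abs_sifted_sub_le hz hα hy)).1
  have h3 : ∑ p ∈ (Finset.Ioc z r).filter Nat.Prime, sifted z (α / p) (y / p) ≤
      ∑ p ∈ (Finset.Ioc z r).filter Nat.Prime,
        (y * siftDensity z * (1 / p : ℝ) + 2 ^ (Nat.primeCounting z - 1)) := by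
    refine Finset.sum_le_sum fun p _ => ?_
    have := (abs_le.1 (abs_sifted_sub_le hz (α := α / p) (y := y / p) (by positivity)
      (by positivity))).2
    have e : y / p * siftDensity z = y * siftDensity z * (1 / p : ℝ) := by ring
    linarith
  rw [Finset.sum_add_distrib, ← Finset.mul_sum, Finset.sum_const, nsmul_eq_mul] at h3
  linarith

/-- The sum of the reciprocals of the primes up to `n`. -/
noncomputable def primeInvSum (n : ℕ) : ℝ := ∑ p ∈ (Finset.range (n + 1)).filter Nat.Prime, (1 / p : ℝ)

lemma primeInvSum_succ_of_prime {n : ℕ} (h : (n + 1).Prime) :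
    primeInvSum (n + 1) = primeInvSum n + 1 / ((n + 1 : ℕ) : ℝ) := by
  rw [primeInvSum, Finset.range_add_one, Finset.filter_insert, if_pos h,
    Finset.sum_insert (by simp), add_comm]
  rfl

lemma primeInvSum_succ_of_not_prime {n : ℕ} (h : ¬ (n + 1).Prime) :
    primeInvSum (n + 1) = primeInvSum n := by
  rw [primeInvSum, Finset.range_add_one, Finset.filter_insert, if_neg h]
  rfl

lemma sum_Ioc_prime_inv {z r : ℕ} (hzr : z ≤ r) :
    ∑ p ∈ (Finset.Ioc z r).filter Nat.Prime, (1 / p : ℝ) = primeInvSum r - primeInvSum z := by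
  rw [eq_sub_iff_add_eq', primeInvSum, primeInvSum, ← Finset.sum_union]
  · congr 1
    rw [← Finset.filter_union]
    congr 1
    ext a
    simp
    omega
  · refine Finset.disjoint_filter_filter (Finset.disjoint_left.2 fun a => ?_)
    simp
    omega

lemma card_Ioc_prime {z r : ℕ} (hzr : z ≤ r) :
    ((Finset.Ioc z r).filter Nat.Prime).card + Nat.primeCounting z = Nat.primeCounting r := by
  rw [Nat.primeCounting, Nat.primeCounting, Nat.primeCounting', Nat.count_eq_card_filter_range,
    Nat.count_eq_card_filter_range, ← Finset.card_union_of_disjoint]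
  · rw [← Finset.filter_union]
    congr 2
    ext a
    simp
    omega
  · refine Finset.disjoint_filter_filter (Finset.disjoint_left.2 fun a => ?_)
    simp
    omega

/-- Every interval of length `π(r) ^ 3` contains an integer free of prime factors up to `r`. -/
def GapBound (r : ℕ) : Prop := ∀ α : ℝ, 0 ≤ α → 0 < sifted r α ((Nat.primeCounting r : ℝ) ^ 3)

lemma gapBound_of_primeInvSum {z r s : ℕ} {V R : ℝ} (hz : 2 ≤ z) (hzr : z ≤ r)
    (hs : Nat.primeCounting r = s) (hV : siftDensity z = V)
    (hR : primeInvSum r - primeInvSum z ≤ R)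
    (h : 2 ^ (Nat.primeCounting z - 1) * ((s : ℝ) + 1 - Nat.primeCounting z) <
      (s : ℝ) ^ 3 * V * (1 - R)) : GapBound r := by
  intro α hα
  have h1 := lt_sifted_of_sum_inv hz hzr hα (y := (Nat.primeCounting r : ℝ) ^ 3) (by positivity)
  have h2 : (((Finset.Ioc z r).filter Nat.Prime).card : ℝ) + Nat.primeCounting z = s := by
    rw [← hs, ← card_Ioc_prime hzr]
    push_cast
    ring
  rw [sum_Ioc_prime_inv hzr, hs, hV] at h1
  rw [hs]
  have h3 : 0 < V := hV ▸ siftDensity_pos z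
  have h4 := mul_le_mul_of_nonneg_left (sub_le_sub_left hR 1)
    (show 0 ≤ (s : ℝ) ^ 3 * V by positivity)
  have h5 : 1 + (((Finset.Ioc z r).filter Nat.Prime).card : ℝ) = s + 1 - Nat.primeCounting z := by
    linarith
  rw [h5] at h1
  linarith

/-! ### A fixed-point computation over the primes up to 263206

All functions here are built from `Nat.rec` and the binary operations on natural numbers that
kernels evaluate natively, and intermediate results are forced. -/

/-- `force n f` is `f n`, evaluated after reducing `n` to a literal. -/
noncomputable def force {α : Type} (n : ℕ) (f : ℕ → α) : α :=
  Nat.rec (f 0) (fun k _ => f (Nat.succ k)) n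

lemma force_eq {α : Type} (n : ℕ) (f : ℕ → α) : force n f = f n := by
  cases n <;> rfl

/-- Binary search for the base-two logarithm of `x` in `[l, l + 2 ^ d)`. -/
noncomputable def bitSearch (x : ℕ) (d : ℕ) : ℕ → ℕ :=
  Nat.rec (fun l => l)
    (fun d ih l => force (Nat.add l (Nat.pow 2 d)) fun l' =>
      cond (Nat.ble (Nat.pow 2 l') x) (ih l') (ih l)) d

lemma bitSearch_spec {x : ℕ} (d : ℕ) : ∀ l, 2 ^ l ≤ x → x < 2 ^ (l + 2 ^ d) →
    2 ^ bitSearch x d l ≤ x ∧ x < 2 ^ (bitSearch x d l + 1) := by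
  induction d with
  | zero => intro l h1 h2; exact ⟨h1, h2⟩
  | succ d ih =>
    intro l h1 h2
    have e : bitSearch x (d + 1) l =
        if 2 ^ (l + 2 ^ d) ≤ x then bitSearch x d (l + 2 ^ d) else bitSearch x d l := by
      change force (Nat.add l (Nat.pow 2 d)) (fun l' =>
        cond (Nat.ble (Nat.pow 2 l') x) (bitSearch x d l') (bitSearch x d l)) = _
      rw [force_eq]
      change cond (Nat.ble (2 ^ (l + 2 ^ d)) x) (bitSearch x d (l + 2 ^ d)) (bitSearch x d l) = _
      simp only [Bool.cond_eq_ite, Nat.ble_eq]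
    rw [e]
    split_ifs with h
    · refine ih _ h ?_
      rwa [add_assoc, ← two_mul, ← pow_succ']
    · exact ih _ h1 (not_le.1 h)

/-- `128` times the base-two logarithm of `n`, rounded down. -/
noncomputable def logBits (n : ℕ) : ℕ := force (Nat.pow n 128) fun x => bitSearch x 12 0

lemma logBits_spec {n : ℕ} (h1 : 1 ≤ n) (h2 : n < 2 ^ 32) :
    (logBits n : ℝ) * Real.log 2 ≤ 128 * Real.log n ∧
      128 * Real.log n ≤ (logBits n + 1) * Real.log 2 := by
  have hx : n ^ 128 < 2 ^ (0 + 2 ^ 12) := by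
    calc n ^ 128 < (2 ^ 32) ^ 128 := Nat.pow_lt_pow_left h2 (by norm_num)
      _ = 2 ^ (0 + 2 ^ 12) := by rw [← pow_mul]; congr 1
  obtain ⟨h3, h4⟩ := bitSearch_spec (x := n ^ 128) 12 0 (Nat.one_le_pow _ _ h1) hx
  have e : bitSearch (n ^ 128) 12 0 = logBits n := by rw [logBits, force_eq]; rfl
  rw [e] at h3 h4
  have h5 : ((2 : ℝ) ^ logBits n) ≤ (n : ℝ) ^ 128 := by exact_mod_cast h3
  have h6 : ((n : ℝ) ^ 128) ≤ 2 ^ (logBits n + 1) := by exact_mod_cast h4.le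
  have hn : (0 : ℝ) < n := by exact_mod_cast h1
  constructor
  · have := Real.log_le_log (by positivity) h5
    rw [Real.log_pow, Real.log_pow] at this
    exact_mod_cast this
  · have := Real.log_le_log (by positivity) h6
    rw [Real.log_pow, Real.log_pow] at this
    exact_mod_cast this

/-- The largest power of `p` of the form `t * p ^ i`, `i ≤ d`, not exceeding `263206`. -/
noncomputable def maxPow (p : ℕ) (d : ℕ) : ℕ → ℕ :=
  Nat.rec (fun t => t)
    (fun _ ih t => force (Nat.mul t p) fun t' => cond (Nat.ble t' 263206) (ih t') t) d

lemma maxPow_spec {p : ℕ} (d : ℕ) : ∀ m, 1 ≤ m → p ^ m ≤ 263206 →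
    ∃ m', 1 ≤ m' ∧ maxPow p d (p ^ m) = p ^ m' ∧ p ^ m' ≤ 263206 := by
  induction d with
  | zero => intro m h h'; exact ⟨m, h, rfl, h'⟩
  | succ d ih =>
    intro m h h'
    have e : maxPow p (d + 1) (p ^ m) =
        if p ^ (m + 1) ≤ 263206 then maxPow p d (p ^ (m + 1)) else p ^ m := by
      change force (Nat.mul (p ^ m) p) (fun t' =>
        cond (Nat.ble t' 263206) (maxPow p d t') (p ^ m)) = _
      rw [force_eq]
      change cond (Nat.ble (p ^ (m + 1)) 263206) (maxPow p d (p ^ (m + 1))) (p ^ m) = _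
      simp only [Bool.cond_eq_ite, Nat.ble_eq]
    rw [e]
    split_ifs with h2
    · exact ih _ (by omega) h2
    · exact ⟨m, h, rfl, h'⟩

/-- Fixed-point approximations, with scale `2 ^ 60`, of the number of primes up to `n`, the
density of the sifted set (from below and above), the sum of prime reciprocals, and two weighted
prime sums (in units of `log 2 / 128`). -/
structure PrimeState where
  c : ℕ
  v : ℕ
  w : ℕ
  r : ℕ
  p : ℕ
  q : ℕ

/-- `forceState s f` is `f s`, evaluated after reducing `s`. -/
noncomputable def forceState {α : Type} (s : PrimeState) (f : PrimeState → α) : α :=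
  PrimeState.rec (fun c v w r p q => f ⟨c, v, w, r, p, q⟩) s

lemma forceState_eq {α : Type} (s : PrimeState) (f : PrimeState → α) : forceState s f = f s := by
  cases s
  rfl

/-- The sufficient condition of `gapBound_of_primeInvSum` for `n ≤ 2040`, and of
`sifted_pos_of_lt` above that, in fixed-point arithmetic. -/
noncomputable def gapCheck (n c r v : ℕ) : Bool :=
  cond (Nat.ble n 57)
    (Nat.ble (Nat.succ (Nat.add (Nat.mul (Nat.mul 36 (Nat.pow 2 60)) (Nat.pred c))
      (Nat.mul (Nat.mul 6 r) (Nat.pow c 3)))) (Nat.mul (Nat.mul 11 (Nat.pow 2 60)) (Nat.pow c 3)))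
  (cond (Nat.ble n 600)
    (Nat.ble (Nat.succ (Nat.add (Nat.mul (Nat.mul 7350 (Nat.pow 2 60)) c)
      (Nat.mul (Nat.mul 210 r) (Nat.pow c 3)))) (Nat.mul (Nat.mul 457 (Nat.pow 2 60)) (Nat.pow c 3)))
  (cond (Nat.ble n 2040)
    (Nat.ble (Nat.succ (Nat.add (Nat.mul (Nat.mul 1600000 (Nat.pow 2 60)) c)
      (Nat.mul (Nat.mul 1000 r) (Nat.pow c 3))))
      (Nat.mul (Nat.mul 2489 (Nat.pow 2 60)) (Nat.pow c 3)))
    (Nat.ble (Nat.succ (Nat.mul 5504000000 (Nat.pow 2 60)))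
      (force (Nat.sub (Nat.pow c 128) c) fun x =>
        Nat.mul (Nat.mul 71241660 v) (bitSearch x 12 0)))))

/-- The updated state after meeting the prime `n`; it has `v = 0` if a check fails. -/
noncomputable def primeStep (n : ℕ) (s : PrimeState) : PrimeState :=
  force (logBits n) fun l =>
  cond (Nat.ble (Nat.mul (Nat.mul 1187362 (Nat.succ l)) s.w) (Nat.mul 128000000 (Nat.pow 2 60)))
    (force (Nat.succ s.c) fun c =>
     force (Nat.div (Nat.mul s.v (Nat.pred n)) n) fun v =>
     force (Nat.succ (Nat.div (Nat.mul s.w (Nat.pred n)) n)) fun w =>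
     force (Nat.succ (Nat.add s.r (Nat.div (Nat.pow 2 60) n))) fun r =>
     force (Nat.succ (Nat.add s.p
      (Nat.div (Nat.mul (Nat.pow 2 60) (Nat.succ l)) (Nat.pred n)))) fun p =>
     force (maxPow n 18 n) fun t =>
     force (Nat.add s.q (Nat.div (Nat.mul (Nat.mul (Nat.pow 2 60) l) (Nat.pred t))
      (Nat.mul t (Nat.pred n)))) fun q =>
     cond (gapCheck n c r v) ⟨c, v, w, r, p, q⟩ ⟨0, 0, 0, 0, 0, 0⟩)
    ⟨0, 0, 0, 0, 0, 0⟩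

/-- One step at an odd number `n`, which is taken to be prime iff it is prime to `M`. -/
noncomputable def oddStep (M n : ℕ) (s : PrimeState) : PrimeState :=
  cond (Nat.beq (Nat.gcd n M) 1) (primeStep n s) s

/-- The steps at `n, n + 2, …, n + 2 ^ (d + 1) - 2`. -/
noncomputable def oddSteps (M : ℕ) (d : ℕ) : ℕ → PrimeState → PrimeState :=
  Nat.rec (fun n s => oddStep M n s)
    (fun d ih n s => forceState (ih n s) fun s' =>
      force (Nat.add n (Nat.pow 2 (Nat.succ d))) fun n' => ih n' s') d

/-- The state at `2`. -/
noncomputable def initState : PrimeState :=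
  ⟨1, Nat.pow 2 59, Nat.pow 2 59, Nat.pow 2 59, Nat.pow 2 67, Nat.sub (Nat.pow 2 67) (Nat.pow 2 49)⟩

/-- The state at `263206`. -/
noncomputable def finalState : PrimeState :=
  forceState (force (Nat.factorial 2) fun M => oddSteps M 1 3 initState) fun s =>
  forceState (force (Nat.factorial 6) fun M => oddSteps M 4 7 s) fun s =>
  forceState (force (Nat.factorial 38) fun M => oddSteps M 9 39 s) fun s =>
  force (Nat.factorial 1062) fun M =>
  forceState (oddSteps M 16 1063 s) fun s => oddSteps M 16 132135 s

/-- The values of the fixed-point computation that are used beyond `263206`. -/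
theorem finalState_bounds : forceState finalState (fun s =>
    cond (Nat.beq s.c 23083) (cond (Nat.beq s.v 51860157257926401)
      (cond (Nat.beq s.w 51860157257947454) (cond (Nat.beq s.p 2535960351144365454322)
      (Nat.beq s.q 2532571197806217605807) false) false) false) false) = true := by
  decide +kernel

lemma sum_primes_succ_of_prime (f : ℕ → ℝ) {n : ℕ} (h : (n + 1).Prime) :
    ∑ p ∈ (Finset.range (n + 1 + 1)).filter Nat.Prime, f p =
      ∑ p ∈ (Finset.range (n + 1)).filter Nat.Prime, f p + f (n + 1) := by
  rw [Finset.range_add_one, Finset.filter_insert, if_pos h, Finset.sum_insert (by simp), add_comm]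

lemma sum_primes_succ_of_not_prime (f : ℕ → ℝ) {n : ℕ} (h : ¬ (n + 1).Prime) :
    ∑ p ∈ (Finset.range (n + 1 + 1)).filter Nat.Prime, f p =
      ∑ p ∈ (Finset.range (n + 1)).filter Nat.Prime, f p := by
  rw [Finset.range_add_one, Finset.filter_insert, if_neg h]

lemma primeCounting_succ_of_prime {n : ℕ} (h : (n + 1).Prime) :
    Nat.primeCounting (n + 1) = Nat.primeCounting n + 1 := by
  simp [Nat.primeCounting, Nat.primeCounting', Nat.count_succ _ (n + 1), h]

lemma primeCounting_succ_of_not_prime {n : ℕ} (h : ¬ (n + 1).Prime) :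
    Nat.primeCounting (n + 1) = Nat.primeCounting n := by
  simp [Nat.primeCounting, Nat.primeCounting', Nat.count_succ _ (n + 1), h]

/-- `∑ log p / (p - 1)` over the primes `p ≤ n`. -/
noncomputable def logWeightSum (n : ℕ) : ℝ :=
  ∑ p ∈ (Finset.range (n + 1)).filter Nat.Prime, Real.log p / ((p : ℝ) - 1)

/-- `∑ log p / p ^ k` over the prime powers `p ^ k ≤ X` with `p ≤ n`. -/
noncomputable def logPowSum (X n : ℕ) : ℝ :=
  ∑ p ∈ (Finset.range (n + 1)).filter Nat.Prime,
    Real.log p * ∑ k ∈ Finset.Icc 1 (Nat.log p X), (1 / (p : ℝ) ^ k)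

lemma siftDensity_seven : siftDensity 7 = 8 / 35 := by
  have : (Finset.range (7 + 1)).filter Nat.Prime = {2, 3, 5, 7} := by decide
  rw [siftDensity, this]; norm_num

lemma siftDensity_twentythree : siftDensity 23 = 36495360 / 223092870 := by
  have : (Finset.range (23 + 1)).filter Nat.Prime = {2, 3, 5, 7, 11, 13, 17, 19, 23} := by decide
  rw [siftDensity, this]; norm_num

lemma siftDensity_three : siftDensity 3 = 1 / 3 := by
  have : (Finset.range (3 + 1)).filter Nat.Prime = {2, 3} := by decide
  rw [siftDensity, this]; norm_num

lemma primeInvSum_three : primeInvSum 3 = 5 / 6 := by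
  have : (Finset.range (3 + 1)).filter Nat.Prime = {2, 3} := by decide
  rw [primeInvSum, this]; norm_num

lemma primeInvSum_seven : primeInvSum 7 = 247 / 210 := by
  have : (Finset.range (7 + 1)).filter Nat.Prime = {2, 3, 5, 7} := by decide
  rw [primeInvSum, this]; norm_num

lemma primeInvSum_twentythree : primeInvSum 23 = 334406399 / 223092870 := by
  have : (Finset.range (23 + 1)).filter Nat.Prime = {2, 3, 5, 7, 11, 13, 17, 19, 23} := by decide
  rw [primeInvSum, this]; norm_num

lemma bitSearch_sub_mul_log_le {c : ℕ} (hc2 : 2 ≤ c) (hc' : c < 2 ^ 32) :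
    (bitSearch (c ^ 128 - c) 12 0 : ℝ) * Real.log 2 ≤ 128 * Real.log c := by
  have hx : 2 ^ 0 ≤ c ^ 128 - c := by
    have : c ^ 2 ≤ c ^ 128 := Nat.pow_le_pow_right (by omega) (by norm_num)
    have h2 : c * 2 ≤ c ^ 2 := by rw [pow_two]; exact Nat.mul_le_mul_left _ hc2
    omega
  have hx2 : c ^ 128 - c < 2 ^ (0 + 2 ^ 12) := by
    calc c ^ 128 - c ≤ c ^ 128 := Nat.sub_le _ _
      _ < (2 ^ 32) ^ 128 := Nat.pow_lt_pow_left hc' (by norm_num)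
      _ = 2 ^ (0 + 2 ^ 12) := by rw [← pow_mul]; congr 1
  have h4 := (bitSearch_spec 12 0 hx hx2).1.trans (Nat.sub_le _ _)
  have h5 : ((2 : ℝ) ^ bitSearch (c ^ 128 - c) 12 0) ≤ (c : ℝ) ^ 128 := by exact_mod_cast h4
  have h6 := Real.log_le_log (by positivity) h5
  rw [Real.log_pow, Real.log_pow] at h6
  exact_mod_cast h6

lemma gapBound_of_gapCheck {n c r v : ℕ} (hn : 3 ≤ n) (hn' : n ≤ 263206)
    (hc : Nat.primeCounting n = c)
    (hv : (v : ℝ) ≤ siftDensity n * 2 ^ 60) (hr : primeInvSum n * 2 ^ 60 ≤ r)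
    (hA : ∀ p ≤ n, 3 ≤ p → p.Prime → 1713 / 1000 * siftDensity (p - 1) * Real.log p ≤ 1)
    (h : gapCheck n c r v = true) : GapBound n := by
  simp only [gapCheck, force_eq, Bool.cond_eq_ite, Nat.ble_eq, Nat.add_eq, Nat.mul_eq, Nat.pow_eq,
    Nat.sub_eq, Nat.succ_eq_add_one, Nat.pred_eq_sub_one] at h
  have hc2 : 2 ≤ c := by
    rw [← hc]
    exact (by decide : 2 ≤ Nat.primeCounting 3).trans (Nat.monotone_primeCounting hn)
  have hcR : (2 : ℝ) ≤ c := by exact_mod_cast hc2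
  have hR : primeInvSum n ≤ r / 2 ^ 60 := by rw [le_div_iff₀ (by positivity)]; exact hr
  split_ifs at h with h1 h2 h3
  · refine gapBound_of_primeInvSum (z := 3) (by norm_num) hn hc siftDensity_three
      (R := r / 2 ^ 60 - 5 / 6) (by rw [primeInvSum_three]; linarith) ?_
    have e : Nat.primeCounting 3 = 2 := by decide
    rw [e]
    have h' : ((36 * 2 ^ 60 * (c - 1 : ℕ) + 6 * r * c ^ 3 + 1 : ℕ) : ℝ) ≤
      ((11 * 2 ^ 60 * c ^ 3 : ℕ) : ℝ) := by
      exact_mod_cast Nat.le_of_ble_eq_true h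
    rw [Nat.cast_add, Nat.cast_add, Nat.cast_mul, Nat.cast_sub (by omega)] at h'
    push_cast at h' ⊢
    linarith
  · refine gapBound_of_primeInvSum (z := 7) (by norm_num) (by omega) hc siftDensity_seven
      (R := r / 2 ^ 60 - 247 / 210) (by rw [primeInvSum_seven]; linarith) ?_
    have e : Nat.primeCounting 7 = 4 := by decide
    rw [e]
    have h' : ((7350 * 2 ^ 60 * c + 210 * r * c ^ 3 + 1 : ℕ) : ℝ) ≤
      ((457 * 2 ^ 60 * c ^ 3 : ℕ) : ℝ) := by
      exact_mod_cast Nat.le_of_ble_eq_true h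
    push_cast at h' ⊢
    linarith
  · refine gapBound_of_primeInvSum (z := 23) (by norm_num) (by omega) hc siftDensity_twentythree
      (R := r / 2 ^ 60 - 334406399 / 223092870) (by rw [primeInvSum_twentythree]; linarith) ?_
    have e : Nat.primeCounting 23 = 9 := by decide
    rw [e]
    have h' : ((1600000 * 2 ^ 60 * c + 1000 * r * c ^ 3 + 1 : ℕ) : ℝ) ≤
      ((2489 * 2 ^ 60 * c ^ 3 : ℕ) : ℝ) := by
      exact_mod_cast Nat.le_of_ble_eq_true h
    push_cast at h' ⊢
    have : (0 : ℝ) ≤ (c : ℝ) ^ 3 := by positivity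
    linarith
  · intro α hα
    have hcn : c ≤ n := by
      rw [← hc, Nat.primeCounting, Nat.primeCounting', Nat.count_succ']
      simpa [Nat.not_prime_zero] using Nat.count_le (n := n) (p := fun k => (k + 1).Prime)
    have h6 := bitSearch_sub_mul_log_le hc2 (by omega)
    generalize bitSearch (c ^ 128 - c) 12 0 = b at h h6
    have hc0 : (0 : ℝ) < c := by linarith
    refine sifted_pos_of_lt (A := 1713 / 1000) (by norm_num) (by norm_num) (by omega) hA hα
      (by rw [hc]; positivity) ?_
    rw [hc, Real.log_pow]
    have h' : ((5504000000 * 2 ^ 60 + 1 : ℕ) : ℝ) ≤ ((71241660 * v * b : ℕ) : ℝ) := by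
      exact_mod_cast Nat.le_of_ble_eq_true h
    push_cast at h' h6 ⊢
    have hlog2 := Real.log_two_gt_d9
    have hV := siftDensity_pos n
    have i1 : (v : ℝ) * (b * Real.log 2) ≤ siftDensity n * 2 ^ 60 * (128 * Real.log c) :=
      mul_le_mul hv h6 (by positivity) (by positivity)
    have i2 : (v : ℝ) * b * 0.6931471803 ≤ v * b * Real.log 2 :=
      mul_le_mul_of_nonneg_left hlog2.le (by positivity)
    linarith

/-- The interpretation of a state at `n`. -/
structure PrimeState.Valid (n : ℕ) (s : PrimeState) : Prop where
  c_eq : Nat.primeCounting n = s.c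
  v_le : (s.v : ℝ) ≤ siftDensity n * 2 ^ 60
  le_w : siftDensity n * 2 ^ 60 ≤ s.w
  le_r : primeInvSum n * 2 ^ 60 ≤ s.r
  le_p : 128 * 2 ^ 60 * logWeightSum n ≤ s.p * Real.log 2
  q_le : s.q * Real.log 2 ≤ 128 * 2 ^ 60 * logPowSum 263206 n
  gap : ∀ r, 3 ≤ r → r ≤ n → GapBound r
  density_le : ∀ p ≤ n, 3 ≤ p → p.Prime → 1713 / 1000 * siftDensity (p - 1) * Real.log p ≤ 1

lemma gapBound_succ_of_not_prime {n : ℕ} (h : ¬ (n + 1).Prime) (hn : GapBound n) :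
    GapBound (n + 1) := by
  intro α hα
  rw [sifted_succ_of_not_prime h, primeCounting_succ_of_not_prime h]
  exact hn α hα

lemma PrimeState.Valid.succ_of_not_prime {n : ℕ} {s : PrimeState} (hs : s.Valid n) (hn : 3 ≤ n)
    (h : ¬ (n + 1).Prime) : s.Valid (n + 1) where
  c_eq := by rw [primeCounting_succ_of_not_prime h, hs.c_eq]
  v_le := by rw [siftDensity_succ_of_not_prime h]; exact hs.v_le
  le_w := by rw [siftDensity_succ_of_not_prime h]; exact hs.le_w
  le_r := by rw [primeInvSum_succ_of_not_prime h]; exact hs.le_r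
  le_p := by rw [logWeightSum, sum_primes_succ_of_not_prime _ h]; exact hs.le_p
  q_le := by rw [logPowSum, sum_primes_succ_of_not_prime _ h]; exact hs.q_le
  gap := by
    intro r h1 h2
    rcases Nat.le_succ_iff.1 h2 with h3 | rfl
    · exact hs.gap r h1 h3
    · exact gapBound_succ_of_not_prime h (hs.gap n hn le_rfl)
  density_le := by
    intro p h1 h2 h3
    rcases Nat.le_succ_iff.1 h1 with h4 | rfl
    · exact hs.density_le p h4 h2 h3
    · exact absurd h3 h

lemma div_le_cast_div_add_one (m n : ℕ) : (m : ℝ) / n ≤ ((m / n : ℕ) : ℝ) + 1 := by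
  rw [← Nat.floor_div_eq_div (K := ℝ)]
  exact (Nat.lt_floor_add_one _).le

lemma sum_Icc_inv_pow {x : ℝ} (hx : 1 < x) (m : ℕ) :
    ∑ k ∈ Finset.Icc 1 m, 1 / x ^ k = (x ^ m - 1) / (x ^ m * (x - 1)) := by
  have h0 : x - 1 ≠ 0 := by linarith
  induction m with
  | zero => simp
  | succ m ih =>
    rw [Finset.sum_Icc_succ_top (by omega), ih]
    have : x ^ m ≠ 0 := by positivity
    have : x ≠ 0 := by positivity
    field_simp
    ring

lemma primeStep_valid {n : ℕ} {s : PrimeState} (hn : 2 ≤ n) (hn' : n + 1 ≤ 263206)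
    (hp : (n + 1).Prime) (hs : 0 < s.v → s.Valid n) (h0 : 0 < (primeStep (n + 1) s).v) :
    (primeStep (n + 1) s).Valid (n + 1) := by
  simp only [primeStep, force_eq, Bool.cond_eq_ite, Nat.ble_eq, Nat.add_eq, Nat.mul_eq, Nat.pow_eq,
    Nat.succ_eq_add_one, Nat.pred_eq_sub_one, show ∀ a b : ℕ, Nat.div a b = a / b from fun _ _ => rfl,
     Nat.add_sub_cancel]
    at h0 ⊢
  obtain ⟨t, ht1, ht2, ht3⟩ := maxPow_spec (p := n + 1) 18 1 le_rfl (by simpa using hn')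
  rw [pow_one] at ht2
  rw [ht2] at h0 ⊢
  obtain ⟨hl1, hl2⟩ := logBits_spec (n := n + 1) (by omega) (by omega)
  generalize logBits (n + 1) = l at *
  split_ifs at h0 ⊢ with ha hb
  · have hv0 : 0 < s.v := by
      rcases Nat.eq_zero_or_pos s.v with h | h
      · simp [h] at h0
      · exact h
    have H := hs hv0
    have hlog2 := Real.log_two_gt_d9
    have hlog2' := Real.log_two_lt_d9
    have hV := siftDensity_pos n
    have hn0 : (0 : ℝ) < (n : ℝ) := by exact_mod_cast (by omega : 0 < n)
    have hVs : siftDensity (n + 1) = siftDensity n * n / (n + 1 : ℕ) := by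
      rw [siftDensity_succ_of_prime hp]
      push_cast
      field_simp
      ring
    have hc : Nat.primeCounting (n + 1) = s.c + 1 := by
      rw [primeCounting_succ_of_prime hp, H.c_eq]
    have hv : ((s.v * n / (n + 1) : ℕ) : ℝ) ≤ siftDensity (n + 1) * 2 ^ 60 := by
      refine Nat.cast_div_le.trans ?_
      rw [hVs, div_mul_eq_mul_div, mul_right_comm, Nat.cast_mul]
      gcongr
      exact H.v_le
    have hr : primeInvSum (n + 1) * 2 ^ 60 ≤ ((s.r + 2 ^ 60 / (n + 1) + 1 : ℕ) : ℝ) := by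
      rw [primeInvSum_succ_of_prime hp]
      have h1 := div_le_cast_div_add_one (2 ^ 60) (n + 1)
      have h2 := H.le_r
      have e : (primeInvSum n + 1 / ((n + 1 : ℕ) : ℝ)) * 2 ^ 60 =
        primeInvSum n * 2 ^ 60 + ((2 ^ 60 : ℕ) : ℝ) / ((n + 1 : ℕ) : ℝ) := by push_cast; ring
      rw [e]
      push_cast at h1 h2 ⊢
      linarith
    have hA : ∀ p ≤ n + 1, 3 ≤ p → p.Prime →
        1713 / 1000 * siftDensity (p - 1) * Real.log p ≤ 1 := by
      intro p h1 h2 h3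
      rcases Nat.le_succ_iff.1 h1 with h4 | rfl
      · exact H.density_le p h4 h2 h3
      · have h5 : ((1187362 * (l + 1) * s.w : ℕ) : ℝ) ≤ ((128000000 * 2 ^ 60 : ℕ) : ℝ) := by
          exact_mod_cast ha
        have h6 := mul_le_mul H.le_w hl2 (by positivity) (by positivity)
        have h7 : (s.w : ℝ) * (l + 1) * Real.log 2 ≤ s.w * (l + 1) * 0.6931471808 :=
          mul_le_mul_of_nonneg_left hlog2'.le (by positivity)
        rw [Nat.succ_eq_add_one, Nat.add_sub_cancel]
        push_cast at h5 h6 h7 ⊢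
        linarith
    have hgap : GapBound (n + 1) := gapBound_of_gapCheck (by omega) hn' hc hv hr hA hb
    refine ⟨hc, hv, ?_, hr, ?_, ?_, ?_, hA⟩
    · have h1 := div_le_cast_div_add_one (s.w * n) (n + 1)
      refine le_trans ?_ (h1.trans_eq (by push_cast; ring))
      rw [hVs, div_mul_eq_mul_div, mul_right_comm, Nat.cast_mul]
      gcongr
      exact H.le_w
    · have h1 := div_le_cast_div_add_one (2 ^ 60 * (l + 1)) n
      have h2 := H.le_p
      rw [logWeightSum, sum_primes_succ_of_prime _ hp, ← logWeightSum]
      have h3 : 128 * 2 ^ 60 * (Real.log (n + 1 : ℕ) / (((n + 1 : ℕ) : ℝ) - 1)) ≤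
          ((2 ^ 60 * (l + 1) : ℕ) : ℝ) / n * Real.log 2 := by
        push_cast at hl2 ⊢
        rw [add_sub_cancel_right, ← mul_div_assoc, div_mul_eq_mul_div]
        refine div_le_div_of_nonneg_right ?_ hn0.le
        linarith
      have h4 := mul_le_mul_of_nonneg_right h1 (Real.log_pos one_lt_two).le
      push_cast at h2 h3 h4 ⊢
      linarith
    · rw [logPowSum, sum_primes_succ_of_prime _ hp, ← logPowSum]
      have h2 := H.q_le
      set x : ℝ := ((n + 1 : ℕ) : ℝ) with hx
      have hx1 : x = n + 1 := by push_cast at hx; exact hx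
      have h1 : ((2 ^ 60 * l * ((n + 1) ^ t - 1) / ((n + 1) ^ t * n) : ℕ) : ℝ) ≤
          2 ^ 60 * l * ∑ k ∈ Finset.Icc 1 t, 1 / x ^ k := by
        refine Nat.cast_div_le.trans_eq ?_
        rw [sum_Icc_inv_pow (by linarith), hx1, add_sub_cancel_right, Nat.cast_mul,
          Nat.cast_sub (Nat.one_le_pow _ _ (by omega))]
        push_cast
        ring
      have h3 : ∑ k ∈ Finset.Icc 1 t, 1 / x ^ k ≤
          ∑ k ∈ Finset.Icc 1 (Nat.log (n + 1) 263206), 1 / x ^ k := by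
        refine Finset.sum_le_sum_of_subset_of_nonneg (Finset.Icc_subset_Icc le_rfl
          (Nat.le_log_of_pow_le (by omega) ht3)) fun k _ _ => by positivity
      have h0 : 0 ≤ ∑ k ∈ Finset.Icc 1 t, 1 / x ^ k := Finset.sum_nonneg fun k _ => by positivity
      have h4 := mul_le_mul_of_nonneg_right h1 (Real.log_pos one_lt_two).le
      have h5 := mul_le_mul hl1 h3 h0 (by positivity)
      push_cast at h2 h4 ⊢
      linarith
    · intro r h1 h2
      rcases Nat.le_succ_iff.1 h2 with h3 | rfl
      · exact H.gap r h1 h3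
      · exact hgap
  · simp at h0
  · simp at h0

lemma gcd_factorial_eq_one_iff {m n : ℕ} (h1 : 2 ≤ n) (h2 : m < n) (h3 : n < (m + 1) ^ 2) :
    Nat.gcd n m.factorial = 1 ↔ n.Prime := by
  constructor
  · intro h
    by_contra hn
    have h4 := Nat.minFac_sq_le_self (by omega) hn
    have h5 : n.minFac < m + 1 := lt_of_pow_lt_pow_left₀ 2 (by omega) (h4.trans_lt h3)
    have h6 : n.minFac ∣ Nat.gcd n m.factorial := Nat.dvd_gcd (Nat.minFac_dvd n)
      (Nat.dvd_factorial (Nat.minFac_pos n) (by omega))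
    rw [h, Nat.dvd_one, Nat.minFac_eq_one_iff] at h6
    omega
  · intro h
    exact (h.coprime_iff_not_dvd).2 fun hd => by
      have := (h.dvd_factorial).1 hd
      omega

lemma oddStep_valid {m e : ℕ} {s : PrimeState} (he : Even e) (h2 : 2 ≤ e) (hm : m ≤ e)
    (hm' : e + 2 ≤ (m + 1) ^ 2) (hX : e + 2 ≤ 263206) (hs : 0 < s.v → s.Valid e)
    (h0 : 0 < (oddStep m.factorial (e + 1) s).v) :
    (oddStep m.factorial (e + 1) s).Valid (e + 2) := by
  have hev : ¬ (e + 1 + 1).Prime := fun h => by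
    have := h.eq_one_or_self_of_dvd 2 (by obtain ⟨t, rfl⟩ := he; exact ⟨t + 1, by ring⟩)
    omega
  have e1 : oddStep m.factorial (e + 1) s =
      if (e + 1).Prime then primeStep (e + 1) s else s := by
    simp only [oddStep, Bool.cond_eq_ite]
    refine if_congr ?_ rfl rfl
    rw [← gcd_factorial_eq_one_iff (m := m) (by omega) (by omega) (by omega)]
    exact Nat.beq_eq ▸ Iff.rfl
  rw [e1] at h0 ⊢
  split_ifs at h0 ⊢ with hp
  · exact (primeStep_valid h2 (by omega) hp hs h0).succ_of_not_prime (by omega) hev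
  · refine ((hs h0).succ_of_not_prime ?_ hp).succ_of_not_prime (by omega) hev
    by_contra h
    obtain rfl : e = 2 := by omega
    exact hp Nat.prime_three

lemma oddSteps_valid {m : ℕ} (d : ℕ) : ∀ {e : ℕ} {s : PrimeState}, Even e → 2 ≤ e → m ≤ e →
    e + 2 ^ (d + 1) ≤ (m + 1) ^ 2 → e + 2 ^ (d + 1) ≤ 263206 → (0 < s.v → s.Valid e) →
    0 < (oddSteps m.factorial d (e + 1) s).v →
    (oddSteps m.factorial d (e + 1) s).Valid (e + 2 ^ (d + 1)) := by
  induction d with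
  | zero =>
    intro e s he h2 hm hm' hX hs h0
    exact oddStep_valid he h2 hm hm' hX hs h0
  | succ d ih =>
    intro e s he h2 hm hm' hX hs h0
    have e1 : oddSteps m.factorial (d + 1) (e + 1) s = oddSteps m.factorial d (e + 2 ^ (d + 1) + 1)
        (oddSteps m.factorial d (e + 1) s) := by
      change forceState (oddSteps m.factorial d (e + 1) s) (fun s' =>
        force (Nat.add (e + 1) (Nat.pow 2 (Nat.succ d))) fun n' => oddSteps m.factorial d n' s') = _
      rw [forceState_eq, force_eq]
      change oddSteps m.factorial d (e + 1 + 2 ^ (d + 1)) _ = _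
      rw [add_right_comm]
    have hd : 2 ^ (d + 1 + 1) = 2 ^ (d + 1) + 2 ^ (d + 1) := by rw [pow_succ, mul_two]
    have hpos := Nat.two_pow_pos d
    rw [e1] at h0 ⊢
    rw [hd, ← add_assoc] at hm' hX ⊢
    refine ih (he.add ?_) (by omega) (by omega) hm' hX
      (ih he h2 hm (by omega) (by omega) hs) h0
    exact (even_two).pow_of_ne_zero (by omega)

lemma initState_valid : initState.Valid 2 := by
  have h2 : (Finset.range (2 + 1)).filter Nat.Prime = {2} := by decide
  have hlog : Nat.log 2 263206 = 18 := by
    rw [Nat.log_eq_iff (by norm_num)]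
    norm_num
  refine ⟨by decide, ?_, ?_, ?_, ?_, ?_, fun r _ _ => by omega, fun p _ _ => by omega⟩
  · rw [siftDensity_two]
    norm_num [initState]
  · rw [siftDensity_two]
    norm_num [initState]
  · rw [primeInvSum, h2]
    norm_num [initState]
  · rw [logWeightSum, h2]
    norm_num [initState]
  · rw [logPowSum, h2, Finset.sum_singleton, hlog, Nat.cast_ofNat,
      sum_Icc_inv_pow (x := 2) (by norm_num)]
    have := Real.log_pos one_lt_two
    norm_num [initState]
    linarith

lemma finalState_valid (h : 0 < finalState.v) : finalState.Valid 263206 := by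
  rw [finalState] at h ⊢
  simp only [forceState_eq, force_eq] at h ⊢
  refine oddSteps_valid (e := 132134) 16 (by decide) (by norm_num) (by norm_num) (by norm_num)
    (by norm_num) ?_ h
  refine oddSteps_valid (e := 1062) 16 (by decide) (by norm_num) (by norm_num) (by norm_num)
    (by norm_num) ?_
  refine oddSteps_valid (e := 38) 9 (by decide) (by norm_num) (by norm_num) (by norm_num)
    (by norm_num) ?_
  refine oddSteps_valid (e := 6) 4 (by decide) (by norm_num) (by norm_num) (by norm_num)
    (by norm_num) ?_
  exact oddSteps_valid (e := 2) 1 (by decide) (by norm_num) (by norm_num) (by norm_num)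
    (by norm_num) fun _ => initState_valid

/-- The result of the computation. -/
lemma exists_valid : ∃ s : PrimeState, s.Valid 263206 ∧ s.c = 23083 ∧ s.v = 51860157257926401 ∧
    s.w = 51860157257947454 ∧ s.p = 2535960351144365454322 ∧ s.q = 2532571197806217605807 := by
  have h := finalState_bounds
  rw [forceState_eq] at h
  have hv := finalState_valid
  generalize finalState = s at h hv
  simp only [Bool.cond_eq_ite, Nat.beq_eq] at h
  split_ifs at h with h1 h2 h3 h4
  exact ⟨s, hv (by omega), h1, h2, h3, h4, by simpa using h⟩

/-! ### Explicit Chebyshev bounds -/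

lemma mul_log_sub_le_log_factorial (n : ℕ) :
    (n : ℝ) * Real.log (n + 1) - n ≤ Real.log n.factorial := by
  induction n with
  | zero => simp
  | succ n ih =>
    rw [Nat.factorial_succ, Nat.cast_mul, Real.log_mul (by positivity) (by positivity)]
    have h1 : Real.log ((n : ℝ) + 1 + 1) ≤ Real.log (n + 1) + 1 / (n + 1) := by
      have := Real.log_le_sub_one_of_pos (x := ((n : ℝ) + 1 + 1) / (n + 1)) (by positivity)
      rw [Real.log_div (by positivity) (by positivity)] at this
      have e : ((n : ℝ) + 1 + 1) / (n + 1) - 1 = 1 / (n + 1) := by field_simp; ring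
      linarith
    have h2 : ((n : ℝ) + 1) * Real.log (n + 1 + 1) ≤ (n + 1) * Real.log (n + 1) + 1 := by
      have := mul_le_mul_of_nonneg_left h1 (by positivity : (0 : ℝ) ≤ n + 1)
      rwa [mul_add, mul_one_div_cancel (by positivity)] at this
    push_cast
    linarith

lemma log_factorial_le {n : ℕ} (hn : 1 ≤ n) :
    Real.log n.factorial ≤ n * Real.log n - n + Real.log n + 1 := by
  induction n, hn using Nat.le_induction with
  | base => simp
  | succ n hn ih =>
    have hn0 : (0 : ℝ) < n := by exact_mod_cast hn
    rw [Nat.factorial_succ, Nat.cast_mul, Real.log_mul (by positivity) (by positivity)]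
    have h1 : Real.log n ≤ Real.log (n + 1) - 1 / (n + 1) := by
      have := Real.log_le_sub_one_of_pos (x := (n : ℝ) / (n + 1)) (by positivity)
      rw [Real.log_div (by positivity) (by positivity)] at this
      have e : (n : ℝ) / (n + 1) - 1 = - (1 / (n + 1)) := by field_simp; ring
      linarith
    have h2 : ((n : ℝ) + 1) * Real.log n ≤ (n + 1) * Real.log (n + 1) - 1 := by
      have := mul_le_mul_of_nonneg_left h1 (by positivity : (0 : ℝ) ≤ n + 1)
      rwa [mul_sub, mul_one_div_cancel (by positivity)] at this
    push_cast
    linarith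

lemma mul_log_sub_mono {x y : ℝ} (hx : 1 ≤ x) (hxy : x ≤ y) :
    x * Real.log x - x ≤ y * Real.log y - y := by
  have h0 : (0 : ℝ) < x := by linarith
  have h1 : Real.log x ≤ Real.log y := Real.log_le_log h0 hxy
  have h2 := Real.one_sub_inv_le_log_of_pos (x := y / x) (div_pos (by linarith) h0)
  rw [Real.log_div (by linarith) h0.ne', inv_div] at h2
  have h3 : y * (1 - x / y) = y - x := by
    have : y ≠ 0 := by linarith
    field_simp
  have h4 := mul_le_mul_of_nonneg_left h2 (by linarith : 0 ≤ y)
  have h5 : (y - x) * 0 ≤ (y - x) * Real.log x :=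
    mul_le_mul_of_nonneg_left (Real.log_nonneg hx) (by linarith)
  linarith

/-- Bounds for the logarithm of `⌊N / m⌋!`. -/
lemma log_factorial_div_bounds {N m : ℕ} (hm : 2 ≤ m) (hmN : m ≤ N) :
    (N : ℝ) / m * (Real.log N - Real.log m) - (N : ℝ) / m - Real.log N ≤
        Real.log (N / m).factorial ∧
      Real.log (N / m).factorial ≤
        (N : ℝ) / m * (Real.log N - Real.log m) - (N : ℝ) / m + Real.log N + 1 := by
  have hm0 : (0 : ℝ) < m := by exact_mod_cast (by omega : 0 < m)
  have hN0 : (0 : ℝ) < N := by exact_mod_cast (by omega : 0 < N)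
  have hM : 1 ≤ N / m := (Nat.one_le_div_iff (by omega)).2 hmN
  have hx : 1 ≤ (N : ℝ) / m := by rw [one_le_div hm0]; exact_mod_cast hmN
  have h1 : ((N / m : ℕ) : ℝ) ≤ (N : ℝ) / m := Nat.cast_div_le
  have h2 : (N : ℝ) / m ≤ ((N / m : ℕ) : ℝ) + 1 := by
    rw [← Nat.floor_div_eq_div (K := ℝ)]
    exact (Nat.lt_floor_add_one _).le
  have hM1 : (1 : ℝ) ≤ ((N / m : ℕ) : ℝ) := by exact_mod_cast hM
  have e : Real.log ((N : ℝ) / m) = Real.log N - Real.log m := Real.log_div hN0.ne' hm0.ne'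
  rw [← e]
  have h3 : ((N / m : ℕ) : ℝ) + 1 ≤ N := by
    have : N / m + 1 ≤ N := by
      have h5 : N / m ≤ N / 2 := Nat.div_le_div_left hm (by norm_num)
      omega
    exact_mod_cast this
  constructor
  · have h4 := mul_log_sub_le_log_factorial (N / m)
    have h5 := mul_log_sub_mono hx h2
    have h6 : Real.log (((N / m : ℕ) : ℝ) + 1) ≤ Real.log N :=
      Real.log_le_log (by linarith) h3
    linarith
  · have h4 := log_factorial_le hM
    have h5 := mul_log_sub_mono hM1 h1
    have h6 : Real.log ((N / m : ℕ) : ℝ) ≤ Real.log N :=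
      Real.log_le_log (by linarith) (by linarith)
    linarith

open ArithmeticFunction in
lemma log_factorial_eq_sum (M : ℕ) :
    Real.log M.factorial = ∑ d ∈ Finset.Ioc 0 M, vonMangoldt d * (M / d : ℕ) := by
  have h : Real.log M.factorial = ∑ n ∈ Finset.Ioc 0 M, Real.log n := by
    induction M with
    | zero => simp
    | succ n ih =>
      rw [Nat.factorial_succ, Nat.cast_mul, Real.log_mul (by positivity) (by positivity), ih,
        ← Finset.insert_Ioc_right_eq_Ioc_add_one (Nat.zero_le n), Finset.sum_insert (by simp)]
  rw [h, ← sum_Ioc_mul_zeta_eq_sum, vonMangoldt_mul_zeta]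
  rfl

open ArithmeticFunction in
lemma log_factorial_div_eq_sum (N m : ℕ) :
    Real.log (N / m).factorial =
      ∑ d ∈ Finset.Ioc 0 N, vonMangoldt d * ((N / d / m : ℕ) : ℝ) := by
  rw [log_factorial_eq_sum]
  have hs : Finset.Ioc 0 (N / m) ⊆ Finset.Ioc 0 N :=
    Finset.Ioc_subset_Ioc le_rfl (Nat.div_le_self _ _)
  rw [← Finset.sum_subset hs]
  · refine Finset.sum_congr rfl fun d _ => ?_
    rw [Nat.div_div_eq_div_mul, Nat.div_div_eq_div_mul, mul_comm m d]
  · intro d _ hd'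
    rw [Finset.mem_Ioc] at *
    have : N / m / d = 0 := Nat.div_eq_of_lt (by omega)
    rw [Nat.div_div_eq_div_mul, mul_comm d, ← Nat.div_div_eq_div_mul, this]
    simp

/-- The constant in Chebyshev's bounds. -/
noncomputable def chebConst : ℝ :=
  Real.log 2 / 2 + Real.log 3 / 3 + Real.log 5 / 5 - Real.log 30 / 30

lemma chebConst_bounds : 0.9212 < chebConst ∧ chebConst < 0.9213 := by
  have e : Real.log 30 = Real.log 2 + Real.log 3 + Real.log 5 := by
    rw [← Real.log_mul (by norm_num) (by norm_num), ← Real.log_mul (by norm_num) (by norm_num)]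
    norm_num
  have h1 := Real.log_two_gt_d9
  have h2 := Real.log_two_lt_d9
  have h3 := Real.log_three_gt_d9
  have h4 := Real.log_three_lt_d9
  have h5 := Real.log_five_gt_d9
  have h6 := Real.log_five_lt_d9
  rw [chebConst, e]
  constructor <;> linarith

open ArithmeticFunction in
lemma psi_bounds {N : ℕ} (hN : 30 ≤ N) :
    chebConst * N - 5 * Real.log N - 3 ≤ Chebyshev.psi N ∧
      Chebyshev.psi N ≤ Chebyshev.psi (N / 6 : ℕ) + chebConst * N + 5 * Real.log N + 2 := by
  have hθ : Real.log N.factorial - Real.log (N / 2).factorial - Real.log (N / 3).factorial -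
      Real.log (N / 5).factorial + Real.log (N / 30).factorial =
      ∑ d ∈ Finset.Ioc 0 N, vonMangoldt d * (((N / d : ℕ) : ℝ) - ((N / d / 2 : ℕ) : ℝ) -
        ((N / d / 3 : ℕ) : ℝ) - ((N / d / 5 : ℕ) : ℝ) + ((N / d / 30 : ℕ) : ℝ)) := by
    rw [log_factorial_eq_sum, log_factorial_div_eq_sum, log_factorial_div_eq_sum,
      log_factorial_div_eq_sum, log_factorial_div_eq_sum, ← Finset.sum_sub_distrib,
      ← Finset.sum_sub_distrib, ← Finset.sum_sub_distrib, ← Finset.sum_add_distrib]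
    exact Finset.sum_congr rfl fun d _ => by ring
  have hc : ∀ q : ℕ, (0 : ℝ) ≤ (q : ℝ) - ((q / 2 : ℕ) : ℝ) - ((q / 3 : ℕ) : ℝ) -
      ((q / 5 : ℕ) : ℝ) + ((q / 30 : ℕ) : ℝ) ∧ (q : ℝ) - ((q / 2 : ℕ) : ℝ) - ((q / 3 : ℕ) : ℝ) -
      ((q / 5 : ℕ) : ℝ) + ((q / 30 : ℕ) : ℝ) ≤ 1 := by
    intro q
    have h1 : q / 2 + q / 3 + q / 5 ≤ q + q / 30 := by omega
    have h2 : q + q / 30 ≤ q / 2 + q / 3 + q / 5 + 1 := by omega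
    have h1' : ((q / 2 : ℕ) : ℝ) + ((q / 3 : ℕ) : ℝ) + ((q / 5 : ℕ) : ℝ) ≤
      q + ((q / 30 : ℕ) : ℝ) := by exact_mod_cast h1
    have h2' : (q : ℝ) + ((q / 30 : ℕ) : ℝ) ≤ ((q / 2 : ℕ) : ℝ) + ((q / 3 : ℕ) : ℝ) +
      ((q / 5 : ℕ) : ℝ) + 1 := by exact_mod_cast h2
    constructor <;> linarith
  have hψ : Chebyshev.psi N = ∑ d ∈ Finset.Ioc 0 N, vonMangoldt d := by
    rw [Chebyshev.psi, Nat.floor_natCast]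
  have hψ6 : Chebyshev.psi (N / 6 : ℕ) = ∑ d ∈ Finset.Ioc 0 (N / 6), vonMangoldt d := by
    rw [Chebyshev.psi, Nat.floor_natCast]
  have hN0 : (0 : ℝ) < N := by exact_mod_cast (by omega : 0 < N)
  have f1 := mul_log_sub_le_log_factorial N
  have f1' := log_factorial_le (n := N) (by omega)
  have f2 := log_factorial_div_bounds (N := N) (m := 2) (by norm_num) (by omega)
  have f3 := log_factorial_div_bounds (N := N) (m := 3) (by norm_num) (by omega)
  have f5 := log_factorial_div_bounds (N := N) (m := 5) (by norm_num) (by omega)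
  have f30 := log_factorial_div_bounds (N := N) (m := 30) (by norm_num) (by omega)
  have f0 : (N : ℝ) * Real.log N ≤ N * Real.log (N + 1) :=
    mul_le_mul_of_nonneg_left (Real.log_le_log hN0 (by linarith)) hN0.le
  have hlog : 0 ≤ Real.log N := Real.log_natCast_nonneg N
  have ha : chebConst * N = N * Real.log N - N - (N / 2 * (Real.log N - Real.log 2) - N / 2) -
      (N / 3 * (Real.log N - Real.log 3) - N / 3) - (N / 5 * (Real.log N - Real.log 5) - N / 5) +
      (N / 30 * (Real.log N - Real.log 30) - N / 30) := by
    rw [chebConst]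
    ring
  push_cast at f2 f3 f5 f30
  constructor
  · have h1 : ∑ d ∈ Finset.Ioc 0 N, vonMangoldt d * (((N / d : ℕ) : ℝ) - ((N / d / 2 : ℕ) : ℝ) -
        ((N / d / 3 : ℕ) : ℝ) - ((N / d / 5 : ℕ) : ℝ) + ((N / d / 30 : ℕ) : ℝ)) ≤
        Chebyshev.psi N := by
      rw [hψ]
      refine Finset.sum_le_sum fun d _ => ?_
      exact mul_le_of_le_one_right vonMangoldt_nonneg (hc _).2
    rw [← hθ] at h1
    linarith [f2.2, f3.2, f5.2, f30.1]
  · have h1 : Chebyshev.psi N - Chebyshev.psi (N / 6 : ℕ) ≤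
        ∑ d ∈ Finset.Ioc 0 N, vonMangoldt d * (((N / d : ℕ) : ℝ) - ((N / d / 2 : ℕ) : ℝ) -
        ((N / d / 3 : ℕ) : ℝ) - ((N / d / 5 : ℕ) : ℝ) + ((N / d / 30 : ℕ) : ℝ)) := by
      have hs : Finset.Ioc 0 (N / 6) ⊆ Finset.Ioc 0 N :=
        Finset.Ioc_subset_Ioc le_rfl (Nat.div_le_self _ _)
      rw [hψ, hψ6, ← Finset.sum_sdiff hs, add_sub_cancel_right, ← Finset.sum_sdiff hs]
      have h2 : 0 ≤ ∑ d ∈ Finset.Ioc 0 (N / 6), vonMangoldt d * (((N / d : ℕ) : ℝ) -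
          ((N / d / 2 : ℕ) : ℝ) - ((N / d / 3 : ℕ) : ℝ) - ((N / d / 5 : ℕ) : ℝ) +
          ((N / d / 30 : ℕ) : ℝ)) :=
        Finset.sum_nonneg fun d _ => mul_nonneg vonMangoldt_nonneg (hc _).1
      have h3 : ∑ d ∈ Finset.Ioc 0 N \ Finset.Ioc 0 (N / 6), vonMangoldt d =
          ∑ d ∈ Finset.Ioc 0 N \ Finset.Ioc 0 (N / 6), vonMangoldt d * (((N / d : ℕ) : ℝ) -
          ((N / d / 2 : ℕ) : ℝ) - ((N / d / 3 : ℕ) : ℝ) - ((N / d / 5 : ℕ) : ℝ) +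
          ((N / d / 30 : ℕ) : ℝ)) := by
        refine Finset.sum_congr rfl fun d hd => ?_
        rw [Finset.mem_sdiff, Finset.mem_Ioc, Finset.mem_Ioc] at hd
        have h4 : 1 ≤ N / d := (Nat.one_le_div_iff hd.1.1).2 hd.1.2
        have h5 : N / d < 6 := (Nat.div_lt_iff_lt_mul hd.1.1).2 (by omega)
        generalize N / d = q at h4 h5
        interval_cases q <;> norm_num
      linarith
    rw [← hθ] at h1
    linarith [f2.1, f3.1, f5.1, f30.2]

lemma psi_le_mul_add (N : ℕ) (hN : 1 ≤ N) :
    Chebyshev.psi N ≤ 6 / 5 * chebConst * N + 157 + 3 * Real.log N ^ 2 := by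
  induction N using Nat.strong_induction_on with
  | _ N ih =>
    have ha := chebConst_bounds
    rcases lt_or_ge N 30 with h | h
    · have h1 := Chebyshev.psi_le_const_mul_self (x := N) (by positivity)
      have h2 : (N : ℝ) ≤ 29 := by exact_mod_cast (by omega : N ≤ 29)
      have h3 : Real.log 4 < 1.4 := by
        rw [Real.log_four_eq]; linarith [Real.log_two_lt_d9]
      have h4 : (Real.log 4 + 4) * N ≤ 5.4 * 29 := by
        refine mul_le_mul (by linarith) h2 (by positivity) (by norm_num)
      have h5 : 0 ≤ 6 / 5 * chebConst * N := by
        have : 0 ≤ chebConst := by linarith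
        positivity
      have h6 := sq_nonneg (Real.log N)
      linarith
    · have hN0 : (0 : ℝ) < N := by exact_mod_cast (by omega : 0 < N)
      have h1 := ih (N / 6) (Nat.div_lt_self (by omega) (by norm_num)) (by omega)
      have h2 := (psi_bounds h).2
      have h3 : ((N / 6 : ℕ) : ℝ) ≤ N / 6 := by
        simpa using (Nat.cast_div_le (α := ℝ) (m := N) (n := 6))
      have h4 : Real.log ((N / 6 : ℕ) : ℝ) ≤ Real.log N - Real.log 6 := by
        rw [← Real.log_div hN0.ne' (by norm_num)]
        exact Real.log_le_log (by exact_mod_cast (by omega : 0 < N / 6)) h3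
      have h6 : Real.log 6 = Real.log 2 + Real.log 3 := by
        rw [← Real.log_mul (by norm_num) (by norm_num)]; norm_num
      have h7 := Real.log_two_gt_d9
      have h8 := Real.log_three_gt_d9
      have h9 : Real.log 30 ≤ Real.log N := Real.log_le_log (by norm_num) (by exact_mod_cast h)
      have h10 : Real.log 30 = Real.log 6 + Real.log 5 := by
        rw [← Real.log_mul (by norm_num) (by norm_num)]; norm_num
      have h11 := Real.log_five_gt_d9
      have h12 : Real.log ((N / 6 : ℕ) : ℝ) ^ 2 ≤ (Real.log N - 1.79) ^ 2 :=
        pow_le_pow_left₀ (Real.log_natCast_nonneg _) (by linarith) 2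
      have h13 : 6 / 5 * chebConst * ((N / 6 : ℕ) : ℝ) ≤ 6 / 5 * chebConst * (N / 6) :=
        mul_le_mul_of_nonneg_left h3 (by linarith)
      nlinarith

/-! ### Explicit Mertens bounds -/

lemma log_factorial_eq_sum_primes (N : ℕ) : Real.log N.factorial =
    ∑ p ∈ (Finset.range (N + 1)).filter Nat.Prime, (N.factorial.factorization p : ℝ) * Real.log p := by
  rw [Real.log_nat_eq_sum_factorization]
  refine Finsupp.sum_of_support_subset _ (fun p hp => ?_) _ (fun p _ => by simp)
  rw [Nat.support_factorization, Nat.mem_primeFactors] at hp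
  rw [Finset.mem_filter, Finset.mem_range]
  exact ⟨Nat.lt_succ_of_le ((hp.1.dvd_factorial).1 hp.2.1), hp.1⟩

lemma log_le_logWeightSum {N : ℕ} (hN : 1 ≤ N) : Real.log (N + 1) - 1 ≤ logWeightSum N := by
  have hN0 : (0 : ℝ) < N := by exact_mod_cast hN
  have h1 : Real.log N.factorial ≤ N * logWeightSum N := by
    rw [log_factorial_eq_sum_primes, logWeightSum, Finset.mul_sum]
    refine Finset.sum_le_sum fun p hp => ?_
    have hp' := (Finset.mem_filter.1 hp).2
    have h2 : (N.factorial.factorization p : ℝ) ≤ N / ((p : ℝ) - 1) := by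
      have h3 : (N.factorial.factorization p : ℝ) ≤ ((N / (p - 1) : ℕ) : ℝ) := by
        exact_mod_cast Nat.factorization_factorial_le_div_pred hp' N
      refine h3.trans (Nat.cast_div_le.trans_eq ?_)
      rw [Nat.cast_sub hp'.one_le, Nat.cast_one]
    calc _ ≤ N / ((p : ℝ) - 1) * Real.log p :=
          mul_le_mul_of_nonneg_right h2 (Real.log_natCast_nonneg p)
      _ = _ := by ring
  have h2 := mul_log_sub_le_log_factorial N
  have h3 : (N : ℝ) * (Real.log (N + 1) - 1) ≤ N * logWeightSum N := by linarith
  exact le_of_mul_le_mul_left h3 hN0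

lemma sum_primes_eq_add {X N : ℕ} (h : X ≤ N) (f : ℕ → ℝ) :
    ∑ p ∈ (Finset.range (N + 1)).filter Nat.Prime, f p =
      ∑ p ∈ (Finset.range (X + 1)).filter Nat.Prime, f p +
        ∑ p ∈ (Finset.Ioc X N).filter Nat.Prime, f p := by
  rw [← Finset.sum_union]
  · congr 1
    ext p
    simp only [Finset.mem_union, Finset.mem_filter, Finset.mem_range, Finset.mem_Ioc]
    constructor
    · rintro ⟨h1, h2⟩
      by_cases h3 : p < X + 1
      · exact Or.inl ⟨h3, h2⟩
      · exact Or.inr ⟨by omega, h2⟩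
    · rintro (⟨h1, h2⟩ | ⟨h1, h2⟩)
      · exact ⟨by omega, h2⟩
      · exact ⟨by omega, h2⟩
  · rw [Finset.disjoint_left]
    intro p h1 h2
    simp only [Finset.mem_filter, Finset.mem_range, Finset.mem_Ioc] at h1 h2
    omega

lemma psi_eq_sum_primes (N : ℕ) : Chebyshev.psi N =
    ∑ p ∈ (Finset.range (N + 1)).filter Nat.Prime, (Nat.log p N : ℝ) * Real.log p := by
  rw [Chebyshev.psi_eq_sum_mul_log_prime]
  refine Finset.sum_congr ?_ fun _ _ => rfl
  ext p
  simp [Nat.mem_primesLE]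

lemma mul_logPowSum_add_le {X N : ℕ} (hXN : X ≤ N) (hN : 1 ≤ N) :
    N * (logPowSum X X + ∑ p ∈ (Finset.Ioc X N).filter Nat.Prime, Real.log p / p) ≤
      Real.log N.factorial + Chebyshev.psi N := by
  have hkey : ∀ p : ℕ, p.Prime → ∀ b ≤ Nat.log p N,
      Real.log p * (N * ∑ k ∈ Finset.Icc 1 b, (1 / (p : ℝ) ^ k)) ≤
        (N.factorial.factorization p : ℝ) * Real.log p + (Nat.log p N : ℝ) * Real.log p := by
    intro p hp b hb
    have hp0 : (0 : ℝ) < p := by exact_mod_cast hp.pos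
    rw [← add_mul, mul_comm (Real.log p)]
    refine mul_le_mul_of_nonneg_right ?_ (Real.log_natCast_nonneg p)
    rw [Nat.factorization_factorial hp (Nat.lt_add_one (Nat.log p N)), Finset.mul_sum]
    have e : Finset.Ico 1 (Nat.log p N + 1) = Finset.Icc 1 (Nat.log p N) := rfl
    calc ∑ k ∈ Finset.Icc 1 b, (N : ℝ) * (1 / (p : ℝ) ^ k)
        ≤ ∑ k ∈ Finset.Icc 1 (Nat.log p N), (N : ℝ) * (1 / (p : ℝ) ^ k) :=
          Finset.sum_le_sum_of_subset_of_nonneg (Finset.Icc_subset_Icc le_rfl hb)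
            fun k _ _ => by positivity
      _ ≤ ∑ k ∈ Finset.Icc 1 (Nat.log p N), (((N / p ^ k : ℕ) : ℝ) + 1) := by
          refine Finset.sum_le_sum fun k _ => ?_
          have := div_le_cast_div_add_one N (p ^ k)
          rw [Nat.cast_pow] at this
          rwa [mul_one_div]
      _ = _ := by
          rw [Finset.sum_add_distrib, e]
          simp
  rw [log_factorial_eq_sum_primes, psi_eq_sum_primes, ← Finset.sum_add_distrib,
    sum_primes_eq_add hXN, mul_add, logPowSum, Finset.mul_sum, Finset.mul_sum]
  refine add_le_add (Finset.sum_le_sum fun p hp => ?_) (Finset.sum_le_sum fun p hp => ?_)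
  · have hp' := (Finset.mem_filter.1 hp).2
    have := hkey p hp' (Nat.log p X) (Nat.log_mono_right hXN)
    refine le_trans (le_of_eq ?_) this
    ring
  · have hp' := (Finset.mem_filter.1 hp).2
    have hp'' := Finset.mem_Ioc.1 (Finset.mem_filter.1 hp).1
    have := hkey p hp' 1 (Nat.log_pos hp'.one_lt hp''.2)
    refine le_trans (le_of_eq ?_) this
    simp
    ring

lemma sum_Ioc_succ {X N : ℕ} (h : X ≤ N) (f : ℕ → ℝ) :
    ∑ n ∈ Finset.Ioc X (N + 1), f n = ∑ n ∈ Finset.Ioc X N, f n + f (N + 1) := by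
  rw [← Finset.insert_Ioc_right_eq_Ioc_add_one h, Finset.sum_insert (by simp), add_comm]

/-- Partial summation from below. -/
lemma le_sum_div_log {X : ℕ} (hX : 1 ≤ X) {a : ℕ → ℝ} {K : ℝ}
    (hS : ∀ N, X ≤ N → Real.log (N + 1) - K ≤ ∑ n ∈ Finset.Ioc X N, a n) {N : ℕ} (hN : X ≤ N) :
    Real.log (Real.log (N + 1) / Real.log (X + 1)) + 1 - K / Real.log (X + 1) ≤
      ∑ n ∈ Finset.Ioc X N, a n / Real.log n := by
  have hl : ∀ M : ℕ, X ≤ M → 0 < Real.log ((M : ℝ) + 1) := fun M hM =>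
    Real.log_pos (by have : (1 : ℝ) ≤ M := by exact_mod_cast hX.trans hM
                     linarith)
  suffices H : Real.log (Real.log (N + 1) / Real.log (X + 1)) -
      K * (1 / Real.log (X + 1) - 1 / Real.log (N + 1)) ≤
      ∑ n ∈ Finset.Ioc X N, a n / Real.log n -
        (∑ n ∈ Finset.Ioc X N, a n) / Real.log (N + 1) by
    have h1 := div_le_div_of_nonneg_right (hS N hN) (hl N hN).le
    have e : (Real.log (N + 1) - K) / Real.log (N + 1) = 1 - K * (1 / Real.log (N + 1)) := by
      have := (hl N hN).ne'
      field_simp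
    rw [e] at h1
    have e2 : K / Real.log (X + 1) = K * (1 / Real.log (X + 1)) := by ring
    linarith
  induction N, hN using Nat.le_induction with
  | base => simp [div_self (hl X le_rfl).ne']
  | succ N hN ih =>
    have h1 := hl N hN
    have h2 := hl (N + 1) (by omega)
    have h3 := hS (N + 1) (by omega)
    rw [sum_Ioc_succ hN] at h3 ⊢
    rw [sum_Ioc_succ hN]
    have h0 := hl X le_rfl
    set l := Real.log ((N : ℝ) + 1) with hldef
    have e : Real.log ((N + 1 : ℕ) : ℝ) = l := by rw [hldef]; push_cast; rfl
    rw [e]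
    set l' := Real.log (((N + 1 : ℕ) : ℝ) + 1)
    have hll : l ≤ l' := Real.log_le_log (by positivity) (by push_cast; linarith)
    have h4 : 0 ≤ 1 / l - 1 / l' := sub_nonneg.2 (one_div_le_one_div_of_le h1 hll)
    have h5 := mul_le_mul_of_nonneg_right h3 h4
    have h6 := Real.log_le_sub_one_of_pos (x := l' / l) (by positivity)
    rw [Real.log_div h2.ne' h1.ne'] at h6
    rw [Real.log_div h2.ne' h0.ne']
    rw [Real.log_div h1.ne' h0.ne'] at ih
    have e1 : (l' - K) * (1 / l - 1 / l') = l' / l - 1 - K * (1 / l - 1 / l') := by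
      field_simp
    set S := ∑ n ∈ Finset.Ioc X N, a n
    have e2 : (S + a (N + 1)) * (1 / l - 1 / l') =
      S / l + a (N + 1) / l - (S + a (N + 1)) / l' := by ring
    rw [e1, e2] at h5
    linarith

/-- Partial summation from above. -/
lemma sum_div_log_le {X : ℕ} (hX : 2 ≤ X) {a : ℕ → ℝ} {K : ℝ}
    (hS : ∀ N, X ≤ N → ∑ n ∈ Finset.Ioc X N, a n ≤ Real.log N - K) {N : ℕ} (hN : X ≤ N) :
    ∑ n ∈ Finset.Ioc X N, a n / Real.log n ≤
      Real.log (Real.log N / Real.log X) + 1 - K / Real.log X := by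
  have hl : ∀ M : ℕ, X ≤ M → 0 < Real.log (M : ℝ) := fun M hM =>
    Real.log_pos (by exact_mod_cast (by omega : 1 < M))
  suffices H : ∑ n ∈ Finset.Ioc X N, a n / Real.log n -
        (∑ n ∈ Finset.Ioc X N, a n) / Real.log N ≤ Real.log (Real.log N / Real.log X) -
      K * (1 / Real.log X - 1 / Real.log N) by
    have h1 := div_le_div_of_nonneg_right (hS N hN) (hl N hN).le
    have e : (Real.log N - K) / Real.log N = 1 - K * (1 / Real.log N) := by
      have := (hl N hN).ne'
      field_simp
    rw [e] at h1
    have e2 : K / Real.log X = K * (1 / Real.log X) := by ring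
    linarith
  induction N, hN using Nat.le_induction with
  | base => simp [div_self (hl X le_rfl).ne']
  | succ N hN ih =>
    have h1 := hl N hN
    have h2 := hl (N + 1) (by omega)
    have h3 := hS N hN
    rw [sum_Ioc_succ hN, sum_Ioc_succ hN]
    have h0 := hl X le_rfl
    have hN0 : (0 : ℝ) < N := by exact_mod_cast (by omega : 0 < N)
    set l := Real.log (N : ℝ)
    set l' := Real.log ((N + 1 : ℕ) : ℝ)
    have hll : l ≤ l' := Real.log_le_log hN0 (by push_cast; linarith)
    have h4 : 0 ≤ 1 / l - 1 / l' := sub_nonneg.2 (one_div_le_one_div_of_le h1 hll)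
    have h5 := mul_le_mul_of_nonneg_right h3 h4
    have h6 := Real.one_sub_inv_le_log_of_pos (x := l' / l) (by positivity)
    rw [Real.log_div h2.ne' h1.ne', inv_div] at h6
    rw [Real.log_div h2.ne' h0.ne']
    rw [Real.log_div h1.ne' h0.ne'] at ih
    have e1 : (l - K) * (1 / l - 1 / l') = 1 - l / l' - K * (1 / l - 1 / l') := by
      field_simp
    set S := ∑ n ∈ Finset.Ioc X N, a n
    have e2 : S * (1 / l - 1 / l') = S / l - S / l' := by ring
    rw [e1, e2] at h5
    have e3 : (S + a (N + 1)) / l' = S / l' + a (N + 1) / l' := by ring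
    rw [e3]
    linarith

lemma siftDensity_eq_mul_exp {X N : ℕ} (h : X ≤ N) : siftDensity N = siftDensity X *
    Real.exp (∑ p ∈ (Finset.Ioc X N).filter Nat.Prime, Real.log (1 - 1 / p)) := by
  induction N, h using Nat.le_induction with
  | base => simp
  | succ N hN ih =>
    rw [← Finset.insert_Ioc_right_eq_Ioc_add_one hN, Finset.filter_insert]
    split_ifs with hp
    · rw [Finset.sum_insert (by simp), Real.exp_add, siftDensity_succ_of_prime hp, ih,
        Real.exp_log]
      · ring
      · have : (1 : ℝ) < ((N + 1 : ℕ) : ℝ) := by exact_mod_cast hp.one_lt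
        rw [sub_pos, div_lt_one (by linarith)]
        exact this
    · rw [siftDensity_succ_of_not_prime hp, ih]

lemma sum_inv_mul_pred_le {X N : ℕ} (hX : 1 ≤ X) (h : X ≤ N) :
    ∑ p ∈ (Finset.Ioc X N).filter Nat.Prime, (1 / ((p : ℝ) - 1) - 1 / p) ≤ 1 / X := by
  have h1 : ∑ n ∈ Finset.Ioc X N, (1 / ((n : ℝ) - 1) - 1 / n) = 1 / X - 1 / N := by
    induction N, h using Nat.le_induction with
    | base => simp
    | succ N hN ih =>
      rw [sum_Ioc_succ hN, ih]
      push_cast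
      ring
  have h2 : ∑ p ∈ (Finset.Ioc X N).filter Nat.Prime, (1 / ((p : ℝ) - 1) - 1 / p) ≤
      ∑ n ∈ Finset.Ioc X N, (1 / ((n : ℝ) - 1) - 1 / n) := by
    refine Finset.sum_le_sum_of_subset_of_nonneg (Finset.filter_subset _ _) fun n hn _ => ?_
    have : (1 : ℝ) < n := by exact_mod_cast (by have := (Finset.mem_Ioc.1 hn).1; omega : 1 < n)
    exact sub_nonneg.2 (one_div_le_one_div_of_le (by linarith) (by linarith))
  have : (0 : ℝ) ≤ 1 / N := by positivity
  linarith

/-! ### The range beyond the computation -/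

lemma log_263206_bounds : 12.48068 < Real.log (263206 : ℕ) ∧ Real.log (263206 : ℕ) < 12.48071 ∧
    12.48068 < Real.log ((263206 : ℕ) + 1) ∧ Real.log ((263206 : ℕ) + 1) < 12.48071 := by
  have key : ∀ t : ℝ, 1 - t⁻¹ + 18 * Real.log 2 ≤ Real.log (2 ^ 18 * t) ∧
      Real.log (2 ^ 18 * t) ≤ t - 1 + 18 * Real.log 2 ∨ t ≤ 0 := by
    intro t
    rcases le_or_gt t 0 with ht | ht
    · exact Or.inr ht
    · rw [Real.log_mul (by positivity) ht.ne', Real.log_pow]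
      have := Real.log_le_sub_one_of_pos ht
      have := Real.one_sub_inv_le_log_of_pos ht
      left
      push_cast
      constructor <;> linarith
  have h2 := Real.log_two_gt_d9
  have h2' := Real.log_two_lt_d9
  rcases key (263206 / 2 ^ 18) with h | h
  swap
  · norm_num at h
  rcases key (263207 / 2 ^ 18) with h' | h'
  swap
  · norm_num at h'
  norm_num at h h' ⊢
  refine ⟨?_, ?_, ?_, ?_⟩ <;> linarith [h.1, h.2, h'.1, h'.2]

lemma sum_Ioc_ite_prime_div_log (X N : ℕ) (b : ℕ → ℝ) :
    ∑ n ∈ Finset.Ioc X N, (if n.Prime then Real.log n * b n else 0) / Real.log n =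
      ∑ p ∈ (Finset.Ioc X N).filter Nat.Prime, b p := by
  rw [Finset.sum_filter]
  refine Finset.sum_congr rfl fun n _ => ?_
  split_ifs with h
  · have : Real.log n ≠ 0 := (Real.log_pos (by exact_mod_cast h.one_lt)).ne'
    field_simp
  · simp

lemma mul_siftDensity_mul_log_le {N : ℕ} (hN : 263206 ≤ N) :
    1713 / 1000 * siftDensity N * Real.log (N + 1) ≤ 1 := by
  obtain ⟨s, hs, -, -, hw, hp, -⟩ := exists_valid
  have hP := hs.le_p
  have hV := hs.le_w
  rw [hp] at hP
  rw [hw] at hV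
  obtain ⟨-, -, hL, hL'⟩ := log_263206_bounds
  have h2 := Real.log_two_lt_d9
  set L := Real.log ((263206 : ℕ) + 1) with hLdef
  set P := logWeightSum 263206 with hPdef
  have hP' : P ≤ 11.9113 := by
    push_cast at hP
    nlinarith
  have hsum : Real.log (Real.log (N + 1) / L) + 1 - (1 + P) / L ≤
      ∑ p ∈ (Finset.Ioc 263206 N).filter Nat.Prime, 1 / ((p : ℝ) - 1) := by
    rw [← sum_Ioc_ite_prime_div_log]
    refine le_sum_div_log (by norm_num) (fun M hM => ?_) hN
    have h1 := log_le_logWeightSum (N := M) (by omega)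
    rw [logWeightSum, sum_primes_eq_add hM, ← logWeightSum] at h1
    rw [← Finset.sum_filter]
    simp only [mul_one_div]
    linarith
  have hdiff := sum_inv_mul_pred_le (X := 263206) (by norm_num) hN
  rw [Finset.sum_sub_distrib] at hdiff
  have hlog : ∑ p ∈ (Finset.Ioc 263206 N).filter Nat.Prime, Real.log (1 - 1 / (p : ℝ)) ≤
      - ∑ p ∈ (Finset.Ioc 263206 N).filter Nat.Prime, 1 / (p : ℝ) := by
    rw [← Finset.sum_neg_distrib]
    refine Finset.sum_le_sum fun p hp => ?_
    have hp' := (Finset.mem_filter.1 hp).2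
    have : (1 : ℝ) < p := by exact_mod_cast hp'.one_lt
    have := Real.log_le_sub_one_of_pos (x := 1 - 1 / (p : ℝ))
      (by rw [sub_pos, div_lt_one (by linarith)]; exact this)
    linarith
  rw [siftDensity_eq_mul_exp hN]
  set S := ∑ p ∈ (Finset.Ioc 263206 N).filter Nat.Prime, Real.log (1 - 1 / (p : ℝ))
  have hlogN : 0 < Real.log (N + 1) := Real.log_pos (by
    have : (263206 : ℝ) ≤ N := by exact_mod_cast hN
    linarith)
  have hL0 : 0 < L := by linarith
  have hK : (1 + P) / L ≤ 1.03451 := by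
    rw [div_le_iff₀ hL0]
    nlinarith
  have hS : Real.log (Real.log (N + 1) / L) - 0.03452 ≤ - S := by
    norm_num at hdiff ⊢
    norm_num at hlog hsum hK
    linarith
  clear_value S L
  have hpos : 0 < Real.log (N + 1) / L := div_pos hlogN hL0
  have hexp : Real.exp S * Real.log (N + 1) * 0.96548 ≤ L := by
    have h1 : Real.exp S ≤ Real.exp (0.03452) / (Real.log (N + 1) / L) := by
      nth_rewrite 1 [← Real.exp_log hpos]
      rw [← Real.exp_sub]
      exact Real.exp_le_exp.2 (by linarith)
    have h2 : Real.exp 0.03452 * 0.96548 ≤ 1 := by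
      have h3 := Real.add_one_le_exp (-0.03452 : ℝ)
      have h4 : Real.exp 0.03452 * Real.exp (-0.03452) = 1 := by
        rw [← Real.exp_add]; norm_num
      have := Real.exp_pos 0.03452
      nlinarith
    rw [le_div_iff₀ hpos, mul_div_assoc', div_le_iff₀ hL0] at h1
    nlinarith
  have hV' : siftDensity 263206 ≤ 0.044982 := by
    norm_num at hV
    linarith
  have hVpos := siftDensity_pos 263206
  have hE : Real.exp S * Real.log (N + 1) ≤ 12.92697 := by
    linarith
  have := mul_le_mul hV' hE (mul_pos (Real.exp_pos S) hlogN).le (by norm_num)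
  linarith

lemma log_error_bounds {N : ℕ} (hN : 263206 ≤ N) :
    3 * Real.log N ^ 2 + Real.log N + 158 ≤ 0.0025 * N ∧ 5 * Real.log N + 3 ≤ 0.0012 * N := by
  obtain ⟨hL, hL', -, -⟩ := log_263206_bounds
  set L := Real.log (263206 : ℕ)
  have hN' : (263206 : ℝ) ≤ N := by exact_mod_cast hN
  obtain ⟨u, hu1, hu⟩ : ∃ u : ℝ, 1 ≤ u ∧ (N : ℝ) = (263206 : ℕ) * u ^ 2 := by
    refine ⟨√(N / 263206), Real.one_le_sqrt.2 ((one_le_div (by norm_num)).2 hN'), ?_⟩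
    rw [Real.sq_sqrt (by positivity)]
    push_cast
    field_simp
  have hu0 : 0 < u := by linarith
  have hlog : Real.log N ≤ L * u := by
    rw [hu, Real.log_mul (by norm_num) (by positivity), Real.log_pow]
    have := Real.log_le_sub_one_of_pos hu0
    change L + ((2 : ℕ) : ℝ) * _ ≤ _
    clear_value L
    push_cast
    nlinarith
  have hlog0 : 0 ≤ Real.log N := Real.log_natCast_nonneg N
  clear_value L
  have hlog1 : Real.log N ≤ 12.48071 * u := by nlinarith
  have hsq : Real.log N ^ 2 ≤ (12.48071 * u) ^ 2 := pow_le_pow_left₀ hlog0 hlog1 2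
  push_cast at hu
  constructor <;> nlinarith

lemma one_le_mul_siftDensity_mul_log {N : ℕ} (hN : 263206 ≤ N) :
    1 ≤ 1.887 * siftDensity N * Real.log N := by
  obtain ⟨s, hs, -, hv, -, -, hq⟩ := exists_valid
  have hQ := hs.q_le
  have hV := hs.v_le
  rw [hq] at hQ
  rw [hv] at hV
  obtain ⟨hL, hL', -, -⟩ := log_263206_bounds
  have h2 := Real.log_two_gt_d9
  set L := Real.log (263206 : ℕ) with hLdef
  set Q := logPowSum 263206 263206 with hQdef
  have hQ' : 11.8953 ≤ Q := by
    push_cast at hQ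
    nlinarith
  have hsum : ∑ p ∈ (Finset.Ioc 263206 N).filter Nat.Prime, 1 / (p : ℝ) ≤
      Real.log (Real.log N / L) + 1 - (Q - 0.10806) / L := by
    rw [← sum_Ioc_ite_prime_div_log]
    refine sum_div_log_le (by norm_num) (fun M hM => ?_) hN
    have h1 := mul_logPowSum_add_le hM (by omega)
    have h3 := log_factorial_le (n := M) (by omega)
    have h4 := psi_le_mul_add M (by omega)
    have h5 := (log_error_bounds hM).1
    have h6 := chebConst_bounds.2
    have hM0 : (263206 : ℝ) ≤ M := by exact_mod_cast hM
    rw [← Finset.sum_filter]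
    simp only [mul_one_div]
    refine le_of_mul_le_mul_left ?_ (by linarith : (0 : ℝ) < M)
    nlinarith
  have hdiff := sum_inv_mul_pred_le (X := 263206) (by norm_num) hN
  rw [Finset.sum_sub_distrib] at hdiff
  have hlog : - ∑ p ∈ (Finset.Ioc 263206 N).filter Nat.Prime, 1 / ((p : ℝ) - 1) ≤
      ∑ p ∈ (Finset.Ioc 263206 N).filter Nat.Prime, Real.log (1 - 1 / (p : ℝ)) := by
    rw [← Finset.sum_neg_distrib]
    refine Finset.sum_le_sum fun p hp => ?_
    have hp' := (Finset.mem_filter.1 hp).2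
    have h1 : (1 : ℝ) < p := by exact_mod_cast hp'.one_lt
    have h3 : (p : ℝ) - 1 ≠ 0 := by linarith
    have := Real.one_sub_inv_le_log_of_pos (x := 1 - 1 / (p : ℝ))
      (by rw [sub_pos, div_lt_one (by linarith)]; exact h1)
    refine le_trans (le_of_eq ?_) this
    have h4 : 1 - 1 / (p : ℝ) = (p - 1) / p := by field_simp
    rw [h4]
    field_simp
    ring
  rw [siftDensity_eq_mul_exp hN]
  set S := ∑ p ∈ (Finset.Ioc 263206 N).filter Nat.Prime, Real.log (1 - 1 / (p : ℝ))
  have hlogN : 0 < Real.log N := Real.log_pos (by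
    have : (263206 : ℝ) ≤ N := by exact_mod_cast hN
    linarith)
  have hL0 : 0 < L := by linarith
  have hK : 0.94443 ≤ (Q - 0.10806) / L := by
    rw [le_div_iff₀ hL0]
    nlinarith
  have hS : - S ≤ Real.log (Real.log N / L) + 0.05558 := by
    norm_num at hdiff ⊢
    norm_num at hlog hsum hK
    linarith
  clear_value S L
  have hpos : 0 < Real.log N / L := div_pos hlogN hL0
  have hexp : 0.94442 * L ≤ Real.exp S * Real.log N := by
    have h1 : Real.exp (-0.05558) / (Real.log N / L) ≤ Real.exp S := by
      nth_rewrite 1 [← Real.exp_log hpos]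
      rw [← Real.exp_sub]
      exact Real.exp_le_exp.2 (by linarith)
    have h3 := Real.add_one_le_exp (-0.05558 : ℝ)
    rw [div_le_iff₀ hpos, mul_div_assoc', le_div_iff₀ hL0] at h1
    nlinarith
  have hV' : 0.0449815 ≤ siftDensity 263206 := by
    norm_num at hV
    linarith
  have hE : 11.7868 ≤ Real.exp S * Real.log N := by
    linarith
  have := mul_le_mul hV' hE (by norm_num) (siftDensity_pos 263206).le
  linarith

lemma mul_log_primeCounting_bound {r : ℕ} (hr : 263206 ≤ r) :
    2.15 * 1.887 * Real.log r < 1713 / 1000 * 3 * Real.log (Nat.primeCounting r) := by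
  obtain ⟨hL, -, -, -⟩ := log_263206_bounds
  have hr0 : (263206 : ℝ) ≤ r := by exact_mod_cast hr
  have hL' : 12.48068 < Real.log r := hL.trans_le (Real.log_le_log (by norm_num) (by simpa using hr0))
  have h1 := (psi_bounds (N := r) (by omega)).1
  have h2 := Chebyshev.psi_le_primeCounting_mul_log r
  have h3 := (log_error_bounds hr).2
  have h4 := chebConst_bounds.1
  have hpi : 0.92 * r / Real.log r ≤ Nat.primeCounting r := by
    rw [div_le_iff₀ (by linarith)]
    nlinarith
  have hlog := Real.log_le_log (by positivity) hpi
  rw [Real.log_div (by positivity) (by linarith), Real.log_mul (by norm_num) (by linarith)] at hlog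
  have h92 := Real.one_sub_inv_le_log_of_pos (x := 0.92) (by norm_num)
  have h125 : Real.log 12.5 = 2 * Real.log 5 - Real.log 2 := by
    rw [show (12.5 : ℝ) = 5 ^ 2 / 2 by norm_num, Real.log_div (by norm_num) (by norm_num),
      Real.log_pow]
    norm_num
  have hLL := Real.log_le_sub_one_of_pos (x := Real.log r / 12.5)
    (div_pos (by linarith) (by norm_num))
  rw [Real.log_div (by linarith) (by norm_num), h125] at hLL
  have h5 := Real.log_five_lt_d9
  have h6 := Real.log_two_gt_d9
  norm_num at h92 hLL hlog hL' ⊢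
  linarith

/-- Every interval of length `π(r)³` contains an integer free of prime factors up to `r`. -/
lemma gapBound (r : ℕ) (hr : 3 ≤ r) : GapBound r := by
  obtain ⟨s, hs, -⟩ := exists_valid
  rcases le_or_gt r 263206 with h | h
  · exact hs.gap r hr h
  intro α hα
  have hbound := mul_log_primeCounting_bound h.le
  have hdens := one_le_mul_siftDensity_mul_log h.le
  have hlog : 0 < Real.log r := Real.log_pos (by exact_mod_cast (by omega : 1 < r))
  have hV := siftDensity_pos r
  have hpi : 0 < Nat.primeCounting r := by
    refine Nat.pos_of_ne_zero fun h0 => ?_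
    rw [h0, Nat.cast_zero, Real.log_zero] at hbound
    linarith
  refine sifted_pos_of_lt (A := 1713 / 1000) (by norm_num) (by norm_num) (by omega)
    (fun p hp h3 hpp => ?_) hα (by positivity) ?_
  · rcases le_or_gt p 263206 with hpX | hpX
    · exact hs.density_le p hpX h3 hpp
    · have := mul_siftDensity_mul_log_le (N := p - 1) (by omega)
      rwa [Nat.cast_sub hpp.one_le, Nat.cast_one, sub_add_cancel] at this
  · rw [Real.log_pow]
    push_cast
    norm_num at hbound hdens ⊢
    nlinarith

lemma coprime_primorialUpTo {n r : ℕ} (h : ∀ p ≤ r, p.Prime → ¬ p ∣ n) :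
    Nat.gcd n (primorialUpTo r) = 1 := by
  refine Nat.Coprime.prod_right fun p hp => ?_
  rw [Finset.mem_filter, Finset.mem_range] at hp
  exact ((hp.2.coprime_iff_not_dvd).2 (h p (by omega) hp.2)).symm

lemma jkr_lt_primeCounting_pow {k r : ℕ} (hr : 3 ≤ r) (hk : Nat.primeCounting r ^ 3 ≤ k) :
    jkr k r < Nat.primeCounting r ^ 3 := by
  have h := gapBound r hr ((k - Nat.primeCounting r ^ 3 : ℕ) : ℝ) (Nat.cast_nonneg _)
  rw [sifted, Nat.cast_pos, Finset.card_pos] at h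
  obtain ⟨n, hn⟩ := h
  rw [Finset.mem_filter, mem_Ioc_floor (Nat.cast_nonneg _) (by positivity)] at hn
  obtain ⟨⟨h1, h2⟩, h3⟩ := hn
  have h1' : k - Nat.primeCounting r ^ 3 < n := by exact_mod_cast h1
  have h2' : n ≤ k - Nat.primeCounting r ^ 3 + Nat.primeCounting r ^ 3 := by exact_mod_cast h2
  have hle : jkr k r ≤ k - n := Nat.sInf_le (by
    change Nat.gcd (k - (k - n)) _ = 1
    rw [show k - (k - n) = n by omega]
    exact coprime_primorialUpTo h3)
  omega

/-- Part III (equality): let `r` be composite and `j = j_{k,r}`. If either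
(i) `j = 2` and `k ≥ 2r - 3`, or (ii) `j ≥ 3` and `k ≥ π(r)³(r-2)`, then
`w₂(k;r) = rk - j(r-2)`. -/
theorem w2_eq_of_r_composite (k r : ℕ) (hr : 2 ≤ r) (hk : r < k)
    (hrc : ¬ r.Prime)
    (hcase : (jkr k r = 2 ∧ 2 * r - 3 ≤ k) ∨
      (3 ≤ jkr k r ∧ (Nat.primeCounting r) ^ 3 * (r - 2) ≤ k)) :
    IsLeast {n : ℕ | 0 < n ∧ vdwProp r (twoColors k) n}
      (r * k - jkr k r * (r - 2)) := by
  have hr3 : 3 ≤ r := by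
    rcases hr.eq_or_lt with rfl | h
    · exact absurd Nat.prime_two hrc
    · exact h
  rcases hcase with ⟨h1, h2⟩ | ⟨h1, h2⟩
  · exact isLeast_vdwProp_of_mul_le hr3 hk hrc h1.ge (by rw [h1]; omega)
  · refine isLeast_vdwProp_of_mul_le hr3 hk hrc (by omega) ((Nat.mul_le_mul_right _ ?_).trans h2)
    exact (jkr_lt_primeCounting_pow hr3 ((Nat.le_mul_of_pos_right _ (by omega)).trans h2)).le
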